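/- arXiv:1802.03504 — 13 statements merged into one kernel-verified Lean document; each statement's English description precedes it below -/
import Mathlib

section
/- Let φ : ℝ^n → (−∞,∞] be proper, let σ ∈ (0,1), and let {(λ_k, z_k, ṽ_k, ε̃_k)}_{k≥1} ⊂ ℝ_{++} × ℝ^n × ℝ^n × ℝ_+ be a sequence (with a given z_0 ∈ dom φ) satisfying the inclusion ṽ_k ∈ ∂_{ε̃_k}(λ_k φ + (1/2)‖·−z_{k−1}‖²)(z_k) for every k ≥ 1. Define δ_k := (1/λ_k)·max{0, ‖ṽ_k‖² + 2ε̃_k − σ‖z_{k−1}−z_k+ṽ_k‖²}. Then for every k ≥ 1: (1/(σλ_k))(‖ṽ_k‖² + 2ε̃_k − λ_k δ_k) ≤ (1/λ_k)‖z_{k−1}−z_k+ṽ_k‖² ≤ (2[φ(z_{k−1}) − φ(z_k)] + δ_k)/(1−σ). -/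
open RealInnerProductSpace

noncomputable section

/-- The ε-subdifferential of an extended-real-valued function `ψ` at `z`:
`∂_ε ψ(z) = {v : ∀ u, ψ(u) ≥ ψ(z) + ⟨v, u − z⟩ − ε}`. -/
def epsSubdiff {n : ℕ} (ψ : EuclideanSpace ℝ (Fin n) → EReal) (ε : EReal)
    (z : EuclideanSpace ℝ (Fin n)) : Set (EuclideanSpace ℝ (Fin n)) :=
  {v | ∀ u, ψ z + ((⟪v, u - z⟫ : ℝ) : EReal) - ε ≤ ψ u}

/-- The effective domain of an extended-real-valued function. -/
def edom {n : ℕ} (ψ : EuclideanSpace ℝ (Fin n) → EReal) : Set (EuclideanSpace ℝ (Fin n)) :=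
  {x | ψ x ≠ ⊤}

/-- `ψ` is proper: it never takes the value `−∞` and is not identically `+∞`. -/
def ProperFun {n : ℕ} (ψ : EuclideanSpace ℝ (Fin n) → EReal) : Prop :=
  (∀ x, ψ x ≠ ⊥) ∧ ∃ x, ψ x ≠ ⊤

/-- Convexity of an extended-real-valued function. -/
def ConvexEReal {n : ℕ} (ψ : EuclideanSpace ℝ (Fin n) → EReal) : Prop :=
  ∀ x y : EuclideanSpace ℝ (Fin n), ∀ α β : ℝ, 0 ≤ α → 0 ≤ β → α + β = 1 →
    ψ (α • x + β • y) ≤ (α : EReal) * ψ x + (β : EReal) * ψ y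

/-- A point with a nonempty `ε`-subdifferential lies in the effective domain as soon as the
effective domain is nonempty. -/
theorem mem_edom_of_mem_epsSubdiff {n : ℕ} {ψ : EuclideanSpace ℝ (Fin n) → EReal} {ε : ℝ}
    {z w u : EuclideanSpace ℝ (Fin n)} (hw : w ∈ epsSubdiff ψ (ε : EReal) z) (hu : u ∈ edom ψ) :
    z ∈ edom ψ := by
  intro hz
  have h := hw u
  rw [hz, EReal.top_add_coe, EReal.top_sub_coe] at h
  exact hu (top_le_iff.mp h)

/-- Positive scaling and adding a real-valued function leave the effective domain unchanged. -/
theorem mem_edom_smul_add_iff {n : ℕ} {φ : EuclideanSpace ℝ (Fin n) → EReal} {l : ℝ} (hl : 0 < l)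
    {q : EuclideanSpace ℝ (Fin n) → ℝ} (hbot : ∀ x, φ x ≠ ⊥) {u : EuclideanSpace ℝ (Fin n)} :
    u ∈ edom (fun x => (l : EReal) * φ x + (q x : EReal)) ↔ u ∈ edom φ := by
  simp only [edom, Set.mem_ofPred_eq]
  induction h : φ u with
  | bot => exact absurd h (hbot u)
  | coe a => exact iff_of_true (EReal.coe_ne_top (l * a + q u)) (EReal.coe_ne_top a)
  | top => simp [EReal.coe_mul_top_of_pos hl]

/-- The residual estimate behind `gipp_residual_bounds`, for real function values. -/
theorem norm_sq_residual_le {E : Type*} [NormedAddCommGroup E] [InnerProductSpace ℝ E]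
    {x y w : E} {l a b ε : ℝ}
    (h : l * a + 1 / 2 * ‖y - x‖ ^ 2 + ⟪w, x - y⟫ - ε ≤ l * b + 1 / 2 * ‖x - x‖ ^ 2) :
    ‖x - y + w‖ ^ 2 ≤ 2 * l * (b - a) + ‖w‖ ^ 2 + 2 * ε := by
  rw [norm_add_sq_real, real_inner_comm]
  rw [norm_sub_rev y x, sub_self, norm_zero] at h
  linarith

/-- Lemma 2.3 of the paper. Bounds on the residuals of a sequence
satisfying the inclusion of the GIPP framework, in terms of
`δ_k = (1/λ_k) max{0, ‖ṽ_k‖² + 2ε̃_k − σ‖z_{k−1} − z_k + ṽ_k‖²}`. -/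
theorem gipp_residual_bounds {n : ℕ} (φ : EuclideanSpace ℝ (Fin n) → EReal)
    (hproper : ProperFun φ) (σ : ℝ) (hσ0 : 0 < σ) (hσ1 : σ < 1)
    (lam : ℕ → ℝ) (z : ℕ → EuclideanSpace ℝ (Fin n))
    (v : ℕ → EuclideanSpace ℝ (Fin n)) (eps : ℕ → ℝ)
    (hz0 : z 0 ∈ edom φ)
    (hlam : ∀ k, 1 ≤ k → 0 < lam k) (heps : ∀ k, 1 ≤ k → 0 ≤ eps k)
    (hincl : ∀ k, 1 ≤ k → v k ∈ epsSubdiff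
      (fun u => (lam k : EReal) * φ u + (((1 : ℝ) / 2 * ‖u - z (k - 1)‖ ^ 2 : ℝ) : EReal))
      ((eps k : ℝ) : EReal) (z k))
    (δ : ℕ → ℝ)
    (hδ : ∀ k, δ k =
      (1 / lam k) * max 0 (‖v k‖ ^ 2 + 2 * eps k - σ * ‖z (k - 1) - z k + v k‖ ^ 2)) :
    ∀ k, 1 ≤ k →
      (1 / (σ * lam k)) * (‖v k‖ ^ 2 + 2 * eps k - lam k * δ k)
          ≤ (1 / lam k) * ‖z (k - 1) - z k + v k‖ ^ 2 ∧
      (((1 / lam k) * ‖z (k - 1) - z k + v k‖ ^ 2 : ℝ) : EReal)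
          ≤ (2 * (φ (z (k - 1)) - φ (z k)) + ((δ k : ℝ) : EReal)) / (((1 - σ : ℝ)) : EReal) := by
  intro k hk
  have hl := hlam k hk
  have hmul : lam k * δ k =
      max 0 (‖v k‖ ^ 2 + 2 * eps k - σ * ‖z (k - 1) - z k + v k‖ ^ 2) := by
    rw [hδ k]
    field_simp
  have hle : ‖v k‖ ^ 2 + 2 * eps k - σ * ‖z (k - 1) - z k + v k‖ ^ 2 ≤ lam k * δ k :=
    hmul ▸ le_max_right _ _
  have hdom : ∀ j, z j ∈ edom φ
    | 0 => hz0
    | j + 1 => (mem_edom_smul_add_iff (hlam (j + 1) j.succ_pos) hproper.1).mp <|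
        mem_edom_of_mem_epsSubdiff (hincl (j + 1) j.succ_pos) <|
          (mem_edom_smul_add_iff (hlam (j + 1) j.succ_pos) hproper.1).mpr hz0
  constructor
  · rw [one_div_mul_eq_div, one_div_mul_eq_div, div_le_div_iff₀ (by positivity) hl]
    nlinarith
  · have h := hincl k hk (z (k - 1))
    beta_reduce at h
    lift φ (z k) to ℝ using ⟨hdom k, hproper.1 _⟩ with a
    lift φ (z (k - 1)) to ℝ using ⟨hdom (k - 1), hproper.1 _⟩ with b
    have hres := norm_sq_residual_le (by exact_mod_cast h)
    have hreal : 1 / lam k * ‖z (k - 1) - z k + v k‖ ^ 2 ≤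
        (2 * (b - a) + δ k) / (1 - σ) := by
      rw [one_div_mul_eq_div, div_le_div_iff₀ hl (by linarith)]
      linarith
    have htwo : (2 : EReal) = ((2 : ℝ) : EReal) := rfl
    rw [htwo]
    rw [← EReal.coe_le_coe_iff, EReal.coe_div] at hreal
    exact_mod_cast hreal
end
end

section
/- Let φ : ℝ^n → (−∞,∞] be proper lower semicontinuous, let σ ∈ (0,1), z_0 ∈ dom φ, and let {(λ_k, z_k, ṽ_k, ε̃_k)}_{k≥1} ⊂ ℝ_{++} × ℝ^n × ℝ^n × ℝ_+ satisfy, for every k ≥ 1, ṽ_k ∈ ∂_{ε̃_k}(λ_k φ + (1/2)‖·−z_{k−1}‖²)(z_k) and ‖ṽ_k‖² + 2ε̃_k ≤ σ‖z_{k−1}−z_k+ṽ_k‖². Then for every u ∈ ℝ^n and every k ≥ 1: φ(z_k) ≤ φ(u) + (1/(2(1−σ)λ_k))‖z_{k−1}−u‖². -/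
open RealInnerProductSpace

noncomputable section

/-- The quadratic estimate behind `gipp_value_bound`, for `a = u - w` and `b = w - z`. -/
theorem half_sq_sub_inner_add_le {E : Type*} [NormedAddCommGroup E] [InnerProductSpace ℝ E]
    {σ ε : ℝ} (hσ0 : 0 < σ) (hσ1 : σ < 1) (hε : 0 ≤ ε) (a b v : E)
    (h : ‖v‖ ^ 2 + 2 * ε ≤ σ * ‖b + v‖ ^ 2) :
    1 / 2 * ‖a‖ ^ 2 - 1 / 2 * ‖b‖ ^ 2 - ⟪v, a + b⟫ + ε ≤ 1 / (2 * (1 - σ)) * ‖a‖ ^ 2 := by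
  have hσ : 0 < 1 - σ := sub_pos.mpr hσ1
  have hbv := norm_add_sq_real b v
  have hyoung := norm_add_sq_real ((1 - σ) • v) (σ • a)
  rw [norm_smul, norm_smul, inner_smul_left, inner_smul_right, Real.norm_of_nonneg hσ.le,
    Real.norm_of_nonneg hσ0.le] at hyoung
  simp only [conj_trivial] at hyoung
  have hsq := sq_nonneg ‖(1 - σ) • v + σ • a‖
  rw [real_inner_comm] at hbv
  rw [inner_add_right, one_div_mul_eq_div (2 * (1 - σ)), le_div_iff₀ (by positivity)]
  have hv : (1 - σ) * ‖v‖ ^ 2 ≤ (1 - σ) * (σ * ‖b + v‖ ^ 2) :=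
    mul_le_mul_of_nonneg_left (by linarith) hσ.le
  have hinner : -(2 * (1 - σ) * ⟪v, a⟫) ≤ (1 - σ) ^ 2 * ‖b + v‖ ^ 2 + σ * ‖a‖ ^ 2 := by
    refine le_of_mul_le_mul_left ?_ hσ0
    nlinarith [mul_le_mul_of_nonneg_left hv hσ.le, hsq, hyoung]
  nlinarith [mul_le_mul_of_nonneg_left h hσ.le]

/-- Lemma 2.4 of the paper. For a GIPP sequence,
`φ(z_k) ≤ φ(u) + ‖z_{k−1} − u‖² / (2(1−σ)λ_k)` for all `u` and `k ≥ 1`. -/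
theorem gipp_value_bound {n : ℕ} (φ : EuclideanSpace ℝ (Fin n) → EReal)
    (hproper : ProperFun φ) (hlsc : LowerSemicontinuous φ)
    (σ : ℝ) (hσ0 : 0 < σ) (hσ1 : σ < 1)
    (lam : ℕ → ℝ) (z : ℕ → EuclideanSpace ℝ (Fin n))
    (v : ℕ → EuclideanSpace ℝ (Fin n)) (eps : ℕ → ℝ)
    (hz0 : z 0 ∈ edom φ)
    (hlam : ∀ k, 1 ≤ k → 0 < lam k) (heps : ∀ k, 1 ≤ k → 0 ≤ eps k)
    (hincl : ∀ k, 1 ≤ k → v k ∈ epsSubdiff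
      (fun u => (lam k : EReal) * φ u + (((1 : ℝ) / 2 * ‖u - z (k - 1)‖ ^ 2 : ℝ) : EReal))
      ((eps k : ℝ) : EReal) (z k))
    (herr : ∀ k, 1 ≤ k → ‖v k‖ ^ 2 + 2 * eps k ≤ σ * ‖z (k - 1) - z k + v k‖ ^ 2) :
    ∀ u : EuclideanSpace ℝ (Fin n), ∀ k, 1 ≤ k →
      φ (z k) ≤ φ u + ((1 / (2 * (1 - σ) * lam k) * ‖z (k - 1) - u‖ ^ 2 : ℝ) : EReal) := by
  intro u k hk
  obtain ⟨hbot, x, hx⟩ := hproper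
  have hl := hlam k hk
  have hin := hincl k hk
  have hz : φ (z k) ≠ ⊤ := by
    intro htop
    have hxk := hin x
    lift φ x to ℝ using ⟨hx, hbot x⟩ with r
    simp only [htop, EReal.coe_mul_top_of_pos hl, EReal.top_add_coe, EReal.top_sub_coe] at hxk
    exact absurd (top_le_iff.mp hxk) (by exact_mod_cast EReal.coe_ne_top _)
  by_cases hu : φ u = ⊤
  · rw [hu, EReal.top_add_coe]
    exact le_top
  have huk := hin u
  simp only at huk
  lift φ (z k) to ℝ using ⟨hz, hbot _⟩ with s
  lift φ u to ℝ using ⟨hu, hbot u⟩ with r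
  norm_cast at huk ⊢
  have hquad := half_sq_sub_inner_add_le hσ0 hσ1 (heps k hk) (u - z (k - 1)) (z (k - 1) - z k)
    (v k) (herr k hk)
  rw [sub_add_sub_cancel, norm_sub_rev (z (k - 1)) (z k)] at hquad
  have hmul : lam k * (1 / (2 * (1 - σ) * lam k) * ‖z (k - 1) - u‖ ^ 2) =
      1 / (2 * (1 - σ)) * ‖u - z (k - 1)‖ ^ 2 := by
    have hσ : 1 - σ ≠ 0 := (sub_pos.mpr hσ1).ne'
    rw [norm_sub_rev]
    field_simp
  refine le_of_mul_le_mul_left ?_ hl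
  rw [mul_add, hmul]
  linarith
end
end

section
/- Let φ : ℝ^n → (−∞,∞] be proper lower semicontinuous, let σ ∈ (0,1), z_0 ∈ dom φ, and let {(λ_k, z_k, ṽ_k, ε̃_k)}_{k≥1} be a GIPP sequence for (φ, σ, z_0). Then for every k ≥ 1: ((1−σ)/(2λ_k))‖z_{k−1}−z_k+ṽ_k‖² ≤ φ(z_{k−1}) − φ(z_k). -/
open RealInnerProductSpace

noncomputable section

/-- Proposition 2.5(a) of the paper. Descent property of the
GIPP framework: `((1−σ)/(2λ_k))‖z_{k−1} − z_k + ṽ_k‖² ≤ φ(z_{k−1}) − φ(z_k)`. -/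
theorem gipp_descent {n : ℕ} (φ : EuclideanSpace ℝ (Fin n) → EReal)
    (hproper : ProperFun φ) (hlsc : LowerSemicontinuous φ)
    (σ : ℝ) (hσ0 : 0 < σ) (hσ1 : σ < 1)
    (lam : ℕ → ℝ) (z : ℕ → EuclideanSpace ℝ (Fin n))
    (v : ℕ → EuclideanSpace ℝ (Fin n)) (eps : ℕ → ℝ)
    (hz0 : z 0 ∈ edom φ)
    (hlam : ∀ k, 1 ≤ k → 0 < lam k) (heps : ∀ k, 1 ≤ k → 0 ≤ eps k)
    (hincl : ∀ k, 1 ≤ k → v k ∈ epsSubdiff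
      (fun u => (lam k : EReal) * φ u + (((1 : ℝ) / 2 * ‖u - z (k - 1)‖ ^ 2 : ℝ) : EReal))
      ((eps k : ℝ) : EReal) (z k))
    (herr : ∀ k, 1 ≤ k → ‖v k‖ ^ 2 + 2 * eps k ≤ σ * ‖z (k - 1) - z k + v k‖ ^ 2) :
    ∀ k, 1 ≤ k →
      (((1 - σ) / (2 * lam k) * ‖z (k - 1) - z k + v k‖ ^ 2 : ℝ) : EReal)
        ≤ φ (z (k - 1)) - φ (z k) := by
  have hfin : ∀ k, φ (z k) ≠ ⊤ := by
    intro k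
    rcases Nat.eq_zero_or_pos k with rfl | hk
    · exact hz0
    intro htop
    obtain ⟨a, ha⟩ : ∃ a : ℝ, φ (z 0) = a :=
      ⟨_, (EReal.coe_toReal hz0 (hproper.1 _)).symm⟩
    have h := hincl k hk (z 0)
    simp only [htop, ha, EReal.coe_mul_top_of_pos (hlam k hk), EReal.top_add_coe,
      EReal.top_sub_coe, ← EReal.coe_mul, ← EReal.coe_add, top_le_iff] at h
    exact EReal.coe_ne_top _ h
  intro k hk
  obtain ⟨a, ha⟩ : ∃ a : ℝ, φ (z (k - 1)) = a :=
    ⟨_, (EReal.coe_toReal (hfin _) (hproper.1 _)).symm⟩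
  obtain ⟨b, hb⟩ : ∃ b : ℝ, φ (z k) = b :=
    ⟨_, (EReal.coe_toReal (hfin _) (hproper.1 _)).symm⟩
  have h := hincl k hk (z (k - 1))
  simp only [ha, hb, ← EReal.coe_mul, ← EReal.coe_add, ← EReal.coe_sub,
    EReal.coe_le_coe_iff, sub_self, norm_zero] at h
  rw [ha, hb, ← EReal.coe_sub, EReal.coe_le_coe_iff]
  have hl := hlam k hk
  have he := herr k hk
  have hexp := norm_add_sq_real (z (k - 1) - z k) (v k)
  rw [real_inner_comm] at hexp
  rw [norm_sub_rev (z k)] at h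
  rw [div_mul_eq_mul_div, div_le_iff₀ (by positivity)]
  nlinarith
end
end

section
/- Let φ : ℝ^n → (−∞,∞] be proper lower semicontinuous with φ_* := inf φ > −∞, let σ ∈ (0,1), z_0 ∈ dom φ, and let {(λ_k, z_k, ṽ_k, ε̃_k)}_{k≥1} be a GIPP sequence for (φ, σ, z_0). Set Λ_k := Σ_{i=1}^k λ_i and R(φ;λ) := inf_{u∈ℝ^n} { (1/2)‖z_0−u‖² + (1−σ)λ(φ(u) − φ_*) }. Then for every k > 1 there exists an index i ≤ k such that (1/λ_i²)‖z_{i−1}−z_i+ṽ_i‖² ≤ 2 R(φ;λ_1) / ((1−σ)² λ_1 (Λ_k − λ_1)). -/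
open RealInnerProductSpace

noncomputable section

/-- The descent inequality for a relative-error proximal step, in real form. -/
lemma relative_error_prox_descent {E : Type*} [NormedAddCommGroup E] [InnerProductSpace ℝ E]
    {x y w : E} {lam e σ p q : ℝ}
    (hincl : lam * q + 1 / 2 * ‖y - x‖ ^ 2 + ⟪w, x - y⟫ - e ≤ lam * p)
    (herr : ‖w‖ ^ 2 + 2 * e ≤ σ * ‖x - y + w‖ ^ 2) :
    (1 - σ) / 2 * ‖x - y + w‖ ^ 2 ≤ lam * (p - q) := by
  have h := norm_add_sq_real (x - y) w
  rw [real_inner_comm] at h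
  rw [norm_sub_rev] at hincl
  linarith

/-- A relative-error proximal step is dominated, up to the factor `1 - σ`, by the
proximal objective at any other point. -/
lemma relative_error_prox_comparison {E : Type*} [NormedAddCommGroup E]
    [InnerProductSpace ℝ E] {x y w u : E} {lam e σ p q : ℝ} (hσ0 : 0 < σ) (hσ1 : σ < 1)
    (hincl : lam * q + 1 / 2 * ‖y - x‖ ^ 2 + ⟪w, u - y⟫ - e
      ≤ lam * p + 1 / 2 * ‖u - x‖ ^ 2)
    (he : 0 ≤ e) (herr : ‖w‖ ^ 2 + 2 * e ≤ σ * ‖x - y + w‖ ^ 2) :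
    (1 - σ) * lam * (q - p) ≤ 1 / 2 * ‖x - u‖ ^ 2 := by
  have h := norm_add_sq_real (x - y) w
  rw [real_inner_comm] at h
  rw [norm_sub_rev y x, norm_sub_rev u x] at hincl
  have hsplit : ⟪w, u - y⟫ = ⟪w, x - y⟫ - ⟪w, x - u⟫ := by
    rw [← inner_sub_right]; congr 1; abel
  have hcs := real_inner_le_norm w (x - u)
  have hw : ‖w‖ ≤ √σ * ‖x - y + w‖ := by
    refine abs_le_of_sq_le_sq' ?_ (by positivity) |>.2
    rw [mul_pow, Real.sq_sqrt hσ0.le]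
    linarith
  have hcs' := hcs.trans (mul_le_mul_of_nonneg_right hw (norm_nonneg (x - u)))
  have hmain : lam * (q - p) ≤ 1 / 2 * ‖x - u‖ ^ 2
      + √σ * ‖x - y + w‖ * ‖x - u‖ - (1 - σ) / 2 * ‖x - y + w‖ ^ 2 := by
    linarith
  have hmul := mul_le_mul_of_nonneg_left hmain (sub_nonneg.2 hσ1.le)
  have hsq := sq_nonneg ((1 - σ) * ‖x - y + w‖ - √σ * ‖x - u‖)
  have hs := Real.sq_sqrt hσ0.le
  have hexp : ((1 - σ) * ‖x - y + w‖ - √σ * ‖x - u‖) ^ 2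
      = (1 - σ) ^ 2 * ‖x - y + w‖ ^ 2 - 2 * (1 - σ) * √σ * ‖x - y + w‖ * ‖x - u‖
        + σ * ‖x - u‖ ^ 2 := by
    linear_combination ‖x - u‖ ^ 2 * hs
  linarith

/-- A sum of weighted terms bounded by the decrease of a sequence has a small term. -/
lemma exists_le_div_sum_of_le_sub {a f c : ℕ → ℝ} {m C : ℝ} {k : ℕ} (hk : 1 < k)
    (ha : ∀ i, 1 ≤ i → 0 < a i) (hf : m ≤ f k)
    (h : ∀ i, 1 ≤ i → a i * c i ≤ C * (f (i - 1) - f i)) (hC : 0 ≤ C) :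
    ∃ i, 1 ≤ i ∧ i ≤ k ∧
      c i ≤ C * (f 1 - m) / ((∑ j ∈ Finset.Icc 1 k, a j) - a 1) := by
  have hIcc : (∑ j ∈ Finset.Icc 1 k, a j) - a 1 = ∑ j ∈ Finset.Ico 1 k, a (j + 1) := by
    rw [← Finset.Ico_add_one_right_eq_Icc, Finset.sum_eq_sum_Ico_succ_bot (by omega),
      Finset.sum_Ico_add' a 1 k 1, add_sub_cancel_left]
  have hpos : 0 < ∑ j ∈ Finset.Ico 1 k, a (j + 1) :=
    Finset.sum_pos (fun i _ => ha _ (by omega)) (Finset.nonempty_Ico.2 hk)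
  rw [hIcc]
  by_contra! hcon
  have hlt : ∑ j ∈ Finset.Ico 1 k,
        a (j + 1) * (C * (f 1 - m) / ∑ j ∈ Finset.Ico 1 k, a (j + 1))
      < ∑ j ∈ Finset.Ico 1 k, a (j + 1) * c (j + 1) := by
    refine Finset.sum_lt_sum_of_nonempty (Finset.nonempty_Ico.2 hk) fun i hi => ?_
    rw [Finset.mem_Ico] at hi
    exact mul_lt_mul_of_pos_left (hcon _ (by omega) (by omega)) (ha _ (by omega))
  rw [← Finset.sum_mul, mul_div_cancel₀ _ hpos.ne'] at hlt
  have hle : ∑ j ∈ Finset.Ico 1 k, a (j + 1) * c (j + 1) ≤ C * (f 1 - f k) := by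
    calc _ ≤ ∑ j ∈ Finset.Ico 1 k, C * (f j - f (j + 1)) :=
          Finset.sum_le_sum fun i _ => h (i + 1) (by omega)
      _ = _ := by
          rw [← Finset.mul_sum, ← neg_sub (f k), ← Finset.sum_Ico_sub f hk.le,
            ← Finset.sum_neg_distrib]
          simp
  have := mul_le_mul_of_nonneg_left hf hC
  linarith

/-- Proposition 2.5(b) of the paper. For a GIPP sequence, with
`Λ_k = Σ_{i=1}^k λ_i` and `R(φ;λ) = inf_u { (1/2)‖z_0 − u‖² + (1−σ)λ(φ(u) − φ_*) }`,
for every `k > 1` there is an index `i ≤ k` with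
`(1/λ_i²)‖z_{i−1} − z_i + ṽ_i‖² ≤ 2R(φ;λ_1) / ((1−σ)²λ_1(Λ_k − λ_1))`. -/
theorem gipp_best_residual_bound {n : ℕ} (φ : EuclideanSpace ℝ (Fin n) → EReal)
    (hproper : ProperFun φ) (hlsc : LowerSemicontinuous φ)
    (φstar : EReal) (hφstar : φstar = ⨅ x, φ x) (hbd : φstar ≠ ⊥)
    (σ : ℝ) (hσ0 : 0 < σ) (hσ1 : σ < 1)
    (lam : ℕ → ℝ) (z : ℕ → EuclideanSpace ℝ (Fin n))
    (v : ℕ → EuclideanSpace ℝ (Fin n)) (eps : ℕ → ℝ)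
    (hz0 : z 0 ∈ edom φ)
    (hlam : ∀ k, 1 ≤ k → 0 < lam k) (heps : ∀ k, 1 ≤ k → 0 ≤ eps k)
    (hincl : ∀ k, 1 ≤ k → v k ∈ epsSubdiff
      (fun u => (lam k : EReal) * φ u + (((1 : ℝ) / 2 * ‖u - z (k - 1)‖ ^ 2 : ℝ) : EReal))
      ((eps k : ℝ) : EReal) (z k))
    (herr : ∀ k, 1 ≤ k → ‖v k‖ ^ 2 + 2 * eps k ≤ σ * ‖z (k - 1) - z k + v k‖ ^ 2)
    (R : ℝ → EReal)
    (hR : ∀ t : ℝ, R t = ⨅ u : EuclideanSpace ℝ (Fin n),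
      (((1 : ℝ) / 2 * ‖z 0 - u‖ ^ 2 : ℝ) : EReal) + (((1 - σ) * t : ℝ) : EReal) * (φ u - φstar)) :
    ∀ k, 1 < k → ∃ i, 1 ≤ i ∧ i ≤ k ∧
      ((1 / (lam i) ^ 2 * ‖z (i - 1) - z i + v i‖ ^ 2 : ℝ) : EReal)
        ≤ 2 * R (lam 1) /
            ((((1 - σ) ^ 2 * lam 1 * ((∑ j ∈ Finset.Icc 1 k, lam j) - lam 1)) : ℝ) : EReal) := by
  have hstar_le : ∀ x, φstar ≤ φ x := fun x => hφstar ▸ iInf_le φ x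
  have hstar_top : φstar ≠ ⊤ := fun h => hz0 (top_le_iff.1 (h ▸ hstar_le (z 0)))
  lift φstar to ℝ using ⟨hstar_top, hbd⟩ with m
  have hcoe : ∀ x, φ x ≠ ⊤ → φ x = ((φ x).toReal : EReal) := fun x hx =>
    (EReal.coe_toReal hx (hproper.1 x)).symm
  have hincl' : ∀ k, 1 ≤ k → ∀ u,
      (lam k : EReal) * φ (z k) + (((1 : ℝ) / 2 * ‖z k - z (k - 1)‖ ^ 2 : ℝ) : EReal)
        + ((⟪v k, u - z k⟫ : ℝ) : EReal) - ((eps k : ℝ) : EReal)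
      ≤ (lam k : EReal) * φ u + (((1 : ℝ) / 2 * ‖u - z (k - 1)‖ ^ 2 : ℝ) : EReal) :=
    fun k hk u => hincl k hk u
  have hdom : ∀ k, φ (z k) ≠ ⊤ := by
    intro k
    rcases Nat.eq_zero_or_pos k with rfl | hk
    · exact hz0
    intro htop
    have h := hincl' k hk (z 0)
    rw [htop, EReal.coe_mul_top_of_pos (hlam k hk), hcoe _ hz0, EReal.top_add_coe,
      EReal.top_add_coe, EReal.top_sub_coe] at h
    norm_cast at h
  have hreal : ∀ k, 1 ≤ k → ∀ u, φ u ≠ ⊤ →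
      lam k * (φ (z k)).toReal + 1 / 2 * ‖z k - z (k - 1)‖ ^ 2 + ⟪v k, u - z k⟫ - eps k
        ≤ lam k * (φ u).toReal + 1 / 2 * ‖u - z (k - 1)‖ ^ 2 := by
    intro k hk u hu
    have h := hincl' k hk u
    rw [hcoe _ (hdom k), hcoe _ hu] at h
    exact_mod_cast h
  have hm : ∀ x, φ x ≠ ⊤ → m ≤ (φ x).toReal := by
    intro x hx
    have h := hstar_le x
    rw [hcoe x hx] at h
    exact_mod_cast h
  have hσ : 0 < 1 - σ := sub_pos.2 hσ1
  have hlam1 := hlam 1 le_rfl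
  have hR1 : (((1 - σ) * lam 1 * ((φ (z 1)).toReal - m) : ℝ) : EReal) ≤ R (lam 1) := by
    rw [hR]
    refine le_iInf fun u => ?_
    by_cases hu : φ u = ⊤
    · rw [hu, EReal.top_sub_coe, EReal.coe_mul_top_of_pos (by positivity), EReal.coe_add_top]
      exact le_top
    rw [hcoe u hu]
    norm_cast
    have h := relative_error_prox_comparison hσ0 hσ1 (hreal 1 le_rfl u hu)
      (heps 1 le_rfl) (herr 1 le_rfl)
    simp only [Nat.sub_self] at h
    linarith
  intro k hk
  obtain ⟨i, hi, hik, hle⟩ := exists_le_div_sum_of_le_sub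
    (a := lam) (f := fun i => (φ (z i)).toReal) (m := m) (C := 2 / (1 - σ))
    (c := fun i => 1 / (lam i) ^ 2 * ‖z (i - 1) - z i + v i‖ ^ 2) hk hlam
    (hm _ (hdom k)) (fun i hi => by
      have hl := hlam i hi
      have h := relative_error_prox_descent (by simpa using hreal i hi _ (hdom (i - 1)))
        (herr i hi)
      field_simp
      linarith) (by positivity)
  refine ⟨i, hi, hik, ?_⟩
  have hΛ : 0 ≤ (∑ j ∈ Finset.Icc 1 k, lam j) - lam 1 :=
    sub_nonneg.2 (Finset.single_le_sum (f := lam)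
      (fun j hj => (hlam j (Finset.mem_Icc.1 hj).1).le) (Finset.mem_Icc.2 ⟨le_rfl, hk.le⟩))
  set S := (∑ j ∈ Finset.Icc 1 k, lam j) - lam 1
  calc ((1 / (lam i) ^ 2 * ‖z (i - 1) - z i + v i‖ ^ 2 : ℝ) : EReal)
      ≤ ((2 * ((1 - σ) * lam 1 * ((φ (z 1)).toReal - m)) / ((1 - σ) ^ 2 * lam 1 * S) : ℝ) :
          EReal) := by
        refine EReal.coe_le_coe_iff.2 (hle.trans_eq ?_)
        field_simp
    _ = 2 * (((1 - σ) * lam 1 * ((φ (z 1)).toReal - m) : ℝ) : EReal)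
          / (((1 - σ) ^ 2 * lam 1 * S : ℝ) : EReal) := by
        rw [EReal.coe_div, EReal.coe_mul 2]
        rfl
    _ ≤ _ := EReal.div_le_div_right_of_nonneg (EReal.coe_nonneg.2 (by positivity))
        (mul_le_mul_of_nonneg_left hR1 (by norm_num))
end
end

section
/- Let φ : ℝ^n → (−∞,∞] be proper lower semicontinuous with φ_* := inf φ > −∞, let σ ∈ (0,1), z_0 ∈ dom φ, λ > 0, and let {(λ_k, z_k, ṽ_k, ε̃_k)}_{k≥1} be a GIPP sequence for (φ, σ, z_0) with λ_k = λ for every k ≥ 1. Set R(φ;λ) := inf_{u∈ℝ^n} { (1/2)‖z_0−u‖² + (1−σ)λ(φ(u) − φ_*) }. Then for every tolerance ρ̄ > 0 and every integer k with k − 1 ≥ 2 R(φ;λ)/(λ²(1−σ)² ρ̄²), there exists an index i ≤ k such that ‖z_{i−1}−z_i+ṽ_i‖ ≤ λ ρ̄. -/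
open RealInnerProductSpace

noncomputable section

section InexactProximalStep

variable {E : Type*} [NormedAddCommGroup E] [InnerProductSpace ℝ E]

/-- Comparison of function values at an inexact proximal step `z₁` from `z₀` and at an arbitrary
point `u`. -/
lemma inexact_prox_step_le {z₀ z₁ v u : E} {a b ε σ : ℝ}
    (hstep : a + 1 / 2 * ‖z₁ - z₀‖ ^ 2 + ⟪v, u - z₁⟫ - ε ≤ b + 1 / 2 * ‖u - z₀‖ ^ 2)
    (herr : ‖v‖ ^ 2 + 2 * ε ≤ σ * ‖z₀ - z₁ + v‖ ^ 2) :
    a - b ≤ 1 / 2 * ‖u - z₀‖ ^ 2 - ⟪v, u - z₀⟫ - (1 - σ) / 2 * ‖z₀ - z₁ + v‖ ^ 2 := by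
  have h₁ : ⟪v, u - z₁⟫ = ⟪v, u - z₀⟫ + ⟪v, z₀ - z₁⟫ := by
    rw [← inner_add_right, sub_add_sub_cancel]
  have h₂ : ‖z₀ - z₁ + v‖ ^ 2 = ‖z₁ - z₀‖ ^ 2 + 2 * ⟪v, z₀ - z₁⟫ + ‖v‖ ^ 2 := by
    rw [norm_add_sq_real, norm_sub_rev, real_inner_comm]
  linarith

lemma neg_mul_inner_le (s t : ℝ) (v d : E) :
    -(2 * (s * t) * ⟪v, d⟫) ≤ s ^ 2 * ‖d‖ ^ 2 + t ^ 2 * ‖v‖ ^ 2 := by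
  have h := norm_add_sq_real (s • d) (t • v)
  rw [norm_smul, norm_smul, mul_pow, mul_pow, Real.norm_eq_abs, Real.norm_eq_abs, sq_abs, sq_abs,
    inner_smul_left, inner_smul_right, real_inner_comm, conj_trivial] at h
  linarith [sq_nonneg ‖s • d + t • v‖]

lemma mul_sub_le_half_sq_of_inexact_prox_step {z₀ z₁ v u : E} {a b ε σ : ℝ}
    (hσ0 : 0 < σ) (hσ1 : σ < 1) (hε : 0 ≤ ε)
    (hstep : a + 1 / 2 * ‖z₁ - z₀‖ ^ 2 + ⟪v, u - z₁⟫ - ε ≤ b + 1 / 2 * ‖u - z₀‖ ^ 2)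
    (herr : ‖v‖ ^ 2 + 2 * ε ≤ σ * ‖z₀ - z₁ + v‖ ^ 2) :
    (1 - σ) * (a - b) ≤ 1 / 2 * ‖z₀ - u‖ ^ 2 := by
  have h := inexact_prox_step_le hstep herr
  have hi := neg_mul_inner_le σ (1 - σ) v (u - z₀)
  rw [norm_sub_rev z₀ u]
  have hv : (1 - σ) ^ 2 * ‖v‖ ^ 2 ≤ (1 - σ) ^ 2 * (σ * ‖z₀ - z₁ + v‖ ^ 2) := by
    gcongr; linarith
  have h' := mul_le_mul_of_nonneg_left h (mul_pos hσ0 (sub_pos.2 hσ1)).le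
  refine le_of_mul_le_mul_left ?_ hσ0
  linarith

lemma residual_sq_le_of_inexact_prox_step {z₀ z₁ v u : E} {a b m ε σ : ℝ}
    (hσ0 : 0 < σ) (hσ1 : σ < 1) (hε : 0 ≤ ε) (ha : m ≤ a) (hb : m ≤ b)
    (hstep : a + 1 / 2 * ‖z₁ - z₀‖ ^ 2 + ⟪v, u - z₁⟫ - ε ≤ b + 1 / 2 * ‖u - z₀‖ ^ 2)
    (herr : ‖v‖ ^ 2 + 2 * ε ≤ σ * ‖z₀ - z₁ + v‖ ^ 2) :
    (1 - σ) ^ 2 / 8 * ‖z₀ - z₁ + v‖ ^ 2 ≤ 1 / 2 * ‖z₀ - u‖ ^ 2 + (1 - σ) * (b - m) := by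
  have h := inexact_prox_step_le hstep herr
  have hi := neg_mul_inner_le (2 * σ) (1 - σ) v (u - z₀)
  rw [norm_sub_rev z₀ u]
  have hv : (1 - σ) ^ 2 * ‖v‖ ^ 2 ≤ (1 - σ) ^ 2 * (σ * ‖z₀ - z₁ + v‖ ^ 2) := by
    gcongr; linarith
  have h' := mul_le_mul_of_nonneg_left h (mul_pos hσ0 (sub_pos.2 hσ1)).le
  have ha' := mul_le_mul_of_nonneg_left ha (mul_pos hσ0 (sub_pos.2 hσ1)).le
  have hb' := mul_nonneg (mul_pos hσ0 (sub_pos.2 hσ1)).le (sub_nonneg.2 hb)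
  have hd : 0 ≤ σ * (1 - σ) * ‖u - z₀‖ ^ 2 :=
    mul_nonneg (mul_pos hσ0 (sub_pos.2 hσ1)).le (sq_nonneg _)
  refine le_of_mul_le_mul_left ?_ hσ0
  linarith

end InexactProximalStep

/-- A decreasing real sequence bounded below cannot decrease by more than `c` too many times. -/
lemma mul_le_sub_of_le_sub_succ {a : ℕ → ℝ} {c m : ℝ} {N : ℕ} (hm : ∀ i, m ≤ a i)
    (h : ∀ i < N, c ≤ a i - a (i + 1)) : N * c ≤ a 0 - m := by
  have hs := Finset.sum_le_sum fun i hi => h i (Finset.mem_range.1 hi)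
  rw [Finset.sum_range_sub', Finset.sum_const, Finset.card_range, nsmul_eq_mul] at hs
  linarith [hm N]

/-- Real-valued reading of membership in the `ε`-subdifferential of a proximal objective. -/
lemma real_le_of_mem_epsSubdiff {n : ℕ} {φ : EuclideanSpace ℝ (Fin n) → EReal}
    (hφ : ∀ x, φ x ≠ ⊥) {lam ε : ℝ} {x z v : EuclideanSpace ℝ (Fin n)}
    (h : v ∈ epsSubdiff
      (fun u => (lam : EReal) * φ u + (((1 : ℝ) / 2 * ‖u - x‖ ^ 2 : ℝ) : EReal)) (ε : EReal) z)
    (hz : φ z ≠ ⊤) {u : EuclideanSpace ℝ (Fin n)} (hu : φ u ≠ ⊤) :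
    lam * (φ z).toReal + 1 / 2 * ‖z - x‖ ^ 2 + ⟪v, u - z⟫ - ε ≤
      lam * (φ u).toReal + 1 / 2 * ‖u - x‖ ^ 2 := by
  have h' := h u
  beta_reduce at h'
  rw [← EReal.coe_toReal hz (hφ z), ← EReal.coe_toReal hu (hφ u)] at h'
  exact_mod_cast h'

lemma ne_top_of_mem_epsSubdiff {n : ℕ} {φ : EuclideanSpace ℝ (Fin n) → EReal}
    (hφ : ∀ x, φ x ≠ ⊥) {lam ε : ℝ} (hlam : 0 < lam) {x z v : EuclideanSpace ℝ (Fin n)}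
    (h : v ∈ epsSubdiff
      (fun u => (lam : EReal) * φ u + (((1 : ℝ) / 2 * ‖u - x‖ ^ 2 : ℝ) : EReal)) (ε : EReal) z)
    {u : EuclideanSpace ℝ (Fin n)} (hu : φ u ≠ ⊤) : φ z ≠ ⊤ := by
  intro hz
  have h' := h u
  beta_reduce at h'
  rw [hz, ← EReal.coe_toReal hu (hφ u), EReal.coe_mul_top_of_pos hlam, EReal.top_add_coe,
    EReal.top_add_coe, EReal.top_sub_coe, top_le_iff] at h'
  exact EReal.coe_ne_top _ (by exact_mod_cast h')

/-- A real lower bound on the finite values of the regularised gap is a lower bound of its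
infimum. -/
lemma coe_le_iInf_regularised_gap {n : ℕ} {φ : EuclideanSpace ℝ (Fin n) → EReal}
    (hφ : ∀ x, φ x ≠ ⊥) {c m B : ℝ} (hc : 0 < c) {x : EuclideanSpace ℝ (Fin n)}
    (hB : ∀ u, φ u ≠ ⊤ → B ≤ 1 / 2 * ‖x - u‖ ^ 2 + c * ((φ u).toReal - m)) :
    (B : EReal) ≤ ⨅ u, (((1 : ℝ) / 2 * ‖x - u‖ ^ 2 : ℝ) : EReal) + (c : EReal) * (φ u - m) := by
  refine le_iInf fun u => ?_
  by_cases hu : φ u = ⊤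
  · rw [hu, EReal.top_sub_coe, EReal.coe_mul_top_of_pos hc, EReal.coe_add_top]
    exact le_top
  · have h := hB u hu
    rw [← EReal.coe_toReal hu (hφ u)]
    exact_mod_cast h

/-- Corollary 2.6(b) of the paper. For a GIPP sequence with constant
stepsize `λ`, for every tolerance `ρ̄ > 0` and every integer `k` with
`k − 1 ≥ 2R(φ;λ)/(λ²(1−σ)²ρ̄²)`, some index `i ≤ k` satisfies
`‖z_{i−1} − z_i + ṽ_i‖ ≤ λρ̄`. -/
theorem gipp_iteration_complexity {n : ℕ} (φ : EuclideanSpace ℝ (Fin n) → EReal)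
    (hproper : ProperFun φ) (hlsc : LowerSemicontinuous φ)
    (φstar : EReal) (hφstar : φstar = ⨅ x, φ x) (hbd : φstar ≠ ⊥)
    (σ : ℝ) (hσ0 : 0 < σ) (hσ1 : σ < 1)
    (lam : ℝ) (hlam : 0 < lam)
    (z : ℕ → EuclideanSpace ℝ (Fin n))
    (v : ℕ → EuclideanSpace ℝ (Fin n)) (eps : ℕ → ℝ)
    (hz0 : z 0 ∈ edom φ)
    (heps : ∀ k, 1 ≤ k → 0 ≤ eps k)
    (hincl : ∀ k, 1 ≤ k → v k ∈ epsSubdiff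
      (fun u => (lam : EReal) * φ u + (((1 : ℝ) / 2 * ‖u - z (k - 1)‖ ^ 2 : ℝ) : EReal))
      ((eps k : ℝ) : EReal) (z k))
    (herr : ∀ k, 1 ≤ k → ‖v k‖ ^ 2 + 2 * eps k ≤ σ * ‖z (k - 1) - z k + v k‖ ^ 2)
    (R : EReal)
    (hR : R = ⨅ u : EuclideanSpace ℝ (Fin n),
      (((1 : ℝ) / 2 * ‖z 0 - u‖ ^ 2 : ℝ) : EReal) + (((1 - σ) * lam : ℝ) : EReal) * (φ u - φstar))
    (ρ : ℝ) (hρ : 0 < ρ) :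
    ∀ k : ℕ, 2 * R / (((lam ^ 2 * (1 - σ) ^ 2 * ρ ^ 2) : ℝ) : EReal) ≤ (((k : ℝ) - 1 : ℝ) : EReal) →
      ∃ i, 1 ≤ i ∧ i ≤ k ∧ ‖z (i - 1) - z i + v i‖ ≤ lam * ρ := by
  intro k hk
  have hφ := hproper.1
  obtain ⟨m, rfl⟩ : ∃ m : ℝ, φstar = m := by
    refine ⟨φstar.toReal, (EReal.coe_toReal (fun h => hz0 ?_) hbd).symm⟩
    exact top_le_iff.1 (h ▸ hφstar ▸ iInf_le φ (z 0))
  have hdom : ∀ i, φ (z i) ≠ ⊤ := by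
    rintro (_ | i)
    · exact hz0
    · exact ne_top_of_mem_epsSubdiff hφ hlam (hincl (i + 1) i.succ_pos) hz0
  have hm : ∀ u, φ u ≠ ⊤ → m ≤ (φ u).toReal := fun u hu => by
    have h := iInf_le φ u
    rwa [← hφstar, ← EReal.coe_toReal hu (hφ u), EReal.coe_le_coe_iff] at h
  have hstep : ∀ i u, φ u ≠ ⊤ → _ := fun i u hu =>
    real_le_of_mem_epsSubdiff hφ (hincl (i + 1) i.succ_pos) (hdom (i + 1)) hu
  simp only [add_tsub_cancel_right] at hstep
  have hσ : 0 < 1 - σ := sub_pos.2 hσ1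
  have herr₁ := herr 1 le_rfl
  rw [Nat.sub_self] at herr₁
  have hR_of : ∀ B : ℝ,
      (∀ u, φ u ≠ ⊤ → B ≤ 1 / 2 * ‖z 0 - u‖ ^ 2 + (1 - σ) * lam * ((φ u).toReal - m)) →
      2 * B ≤ (k - 1) * (lam ^ 2 * (1 - σ) ^ 2 * ρ ^ 2) := by
    intro B hB
    have hBR : (B : EReal) ≤ R := hR ▸ coe_le_iInf_regularised_gap hφ (mul_pos hσ hlam) hB
    have hpos : 0 < lam ^ 2 * (1 - σ) ^ 2 * ρ ^ 2 := by positivity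
    have h : 2 * (B : EReal) / ((lam ^ 2 * (1 - σ) ^ 2 * ρ ^ 2 : ℝ) : EReal) ≤
        (((k : ℝ) - 1 : ℝ) : EReal) :=
      (EReal.div_le_div_right_of_nonneg (by exact_mod_cast hpos.le)
        (mul_le_mul_of_nonneg_left hBR (by norm_num))).trans hk
    have h' : 2 * B / (lam ^ 2 * (1 - σ) ^ 2 * ρ ^ 2) ≤ (k : ℝ) - 1 := by
      rw [← EReal.coe_le_coe_iff, EReal.coe_div, EReal.coe_mul]
      exact h
    exact (div_le_iff₀ hpos).1 h'
  have hgap : ∀ u, φ u ≠ ⊤ → (1 - σ) * lam * ((φ (z 1)).toReal - m) ≤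
      1 / 2 * ‖z 0 - u‖ ^ 2 + (1 - σ) * lam * ((φ u).toReal - m) := fun u hu => by
    linarith [mul_sub_le_half_sq_of_inexact_prox_step hσ0 hσ1 (heps 1 le_rfl) (hstep 0 u hu)
      herr₁]
  have hres : ∀ u, φ u ≠ ⊤ → (1 - σ) ^ 2 / 8 * ‖z 0 - z 1 + v 1‖ ^ 2 ≤
      1 / 2 * ‖z 0 - u‖ ^ 2 + (1 - σ) * lam * ((φ u).toReal - m) := fun u hu => by
    linarith [residual_sq_le_of_inexact_prox_step hσ0 hσ1 (heps 1 le_rfl)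
      (mul_le_mul_of_nonneg_left (hm _ (hdom 1)) hlam.le)
      (mul_le_mul_of_nonneg_left (hm u hu) hlam.le) (hstep 0 u hu) herr₁]
  by_contra! hcon
  have hρ' : 0 < lam * ρ := mul_pos hlam hρ
  have hres' := hR_of _ hres
  obtain _ | _ | N := k
  · have : 0 ≤ (1 - σ) ^ 2 / 8 * ‖z 0 - z 1 + v 1‖ ^ 2 := by positivity
    have : 0 < lam ^ 2 * (1 - σ) ^ 2 * ρ ^ 2 := by positivity
    push_cast at hres'
    linarith
  · have hr : 0 < ‖z 0 - z 1 + v 1‖ := hρ'.trans (hcon 1 le_rfl le_rfl)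
    have : 0 < (1 - σ) ^ 2 / 8 * ‖z 0 - z 1 + v 1‖ ^ 2 := by positivity
    push_cast at hres'
    linarith
  · have hdec : ∀ i, (1 - σ) / 2 * ‖z i - z (i + 1) + v (i + 1)‖ ^ 2 ≤
        lam * (φ (z i)).toReal - lam * (φ (z (i + 1))).toReal := fun i => by
      have h := inexact_prox_step_le (hstep i (z i) (hdom i)) (herr (i + 1) i.succ_pos)
      simp only [sub_self, norm_zero, inner_zero_right] at h
      linarith
    have hlt : ∀ i < N + 2, (1 - σ) / 2 * (lam * ρ) ^ 2 <
        lam * (φ (z i)).toReal - lam * (φ (z (i + 1))).toReal := fun i hi => by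
      refine lt_of_lt_of_le ?_ (hdec i)
      gcongr
      exact hcon (i + 1) i.succ_pos hi
    have hsum := mul_le_sub_of_le_sub_succ (a := fun i => lam * (φ (z (i + 2))).toReal) (N := N)
      (fun i => mul_le_mul_of_nonneg_left (hm _ (hdom (i + 2))) hlam.le)
      (fun i hi => (hlt (i + 2) (by lia)).le)
    have htotal : (N + 1) * ((1 - σ) / 2 * (lam * ρ) ^ 2) < lam * ((φ (z 1)).toReal - m) := by
      have := hlt 1 (by lia)
      simp only [zero_add] at hsum this
      linarith
    have hB := hR_of _ hgap
    have := mul_lt_mul_of_pos_left htotal hσ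
    push_cast at hB
    linarith
end
end

section
/- Let h : ℝ^n → (−∞,∞] be proper lower semicontinuous convex and let g be differentiable on dom h with −(m/2)‖u−z‖² ≤ g(u) − ℓ_g(u;z) ≤ (M/2)‖u−z‖² for all z,u ∈ dom h, where 0 < m ≤ M. Let λ > 0 satisfy λ ≤ 1/m and λ < 2/M, let z_{k−1} ∈ dom h, and let z_k be a minimizer over ℝ^n of u ↦ ℓ_g(u; z_{k−1}) + (1/(2λ))‖u−z_{k−1}‖² + h(u). Define ṽ_k := z_{k−1} − z_k and ε̃_k := λ[ g(z_k) − ℓ_g(z_k; z_{k−1}) + (1/(2λ))‖z_k−z_{k−1}‖² ]. Then ε̃_k ≥ 0, ṽ_k ∈ ∂_{ε̃_k}( λ(g+h) + (1/2)‖·−z_{k−1}‖² )(z_k), and ‖ṽ_k‖² + 2ε̃_k ≤ σ‖z_{k−1}−z_k+ṽ_k‖² with σ := (λM+2)/4 < 1. -/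
open RealInnerProductSpace

noncomputable section

/-- A quadratic without constant term that is nonnegative on `(0, 1]` has nonnegative slope at `0`. -/
theorem nonneg_of_forall_mul_add_sq_mul_nonneg {a b : ℝ} (hb : 0 ≤ b)
    (hab : ∀ t : ℝ, 0 < t → t ≤ 1 → 0 ≤ t * a + t ^ 2 * b) : 0 ≤ a := by
  by_contra! ha
  have hd : 0 < b - a := by linarith
  have key := hab (-a / (b - a)) (div_pos (by linarith) hd)
    ((div_le_one hd).2 (by linarith))
  have heq : -a / (b - a) * a + (-a / (b - a)) ^ 2 * b = a ^ 3 / (b - a) ^ 2 := by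
    field_simp
    ring
  rw [heq] at key
  have : a ^ 3 / (b - a) ^ 2 < 0 :=
    div_neg_of_neg_of_pos (by nlinarith [sq_pos_of_neg ha]) (by positivity)
  linarith

/-- First-order optimality for a proximal step: if `z` minimizes
`⟪p, · - y⟫ + ‖· - y‖² / (2λ) + h` with `h` convex, then `(y - z) / λ` is a subgradient of
`⟪p, ·⟫ + h` at `z`. -/
theorem prox_step_optimality {n : ℕ} {h : EuclideanSpace ℝ (Fin n) → EReal}
    (hbot : ∀ x, h x ≠ ⊥) (hconv : ConvexEReal h) {c lam : ℝ} (hlam : 0 < lam)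
    {p y z u : EuclideanSpace ℝ (Fin n)} (hz : h z ≠ ⊤) (hu : h u ≠ ⊤)
    (hmin : ∀ w : EuclideanSpace ℝ (Fin n),
      ((c + ⟪p, z - y⟫ + 1 / (2 * lam) * ‖z - y‖ ^ 2 : ℝ) : EReal) + h z
        ≤ ((c + ⟪p, w - y⟫ + 1 / (2 * lam) * ‖w - y‖ ^ 2 : ℝ) : EReal) + h w) :
    lam * (h z).toReal + ⟪y - z, u - z⟫ ≤ lam * ((h u).toReal + ⟪p, u - z⟫) := by
  have hzc := EReal.coe_toReal hz (hbot z)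
  have huc := EReal.coe_toReal hu (hbot u)
  set r := (h z).toReal
  set s := (h u).toReal
  suffices 0 ≤ lam * (s + ⟪p, u - z⟫ - r) - ⟪y - z, u - z⟫ by linarith
  refine nonneg_of_forall_mul_add_sq_mul_nonneg (b := ‖u - z‖ ^ 2 / 2) (by positivity) ?_
  intro t ht ht1
  have hw := (hmin ((1 - t) • z + t • u)).trans
    (add_le_add_right (hconv z u (1 - t) t (by linarith) ht.le (by ring)) _)
  rw [← hzc, ← huc] at hw
  norm_cast at hw
  have hsub : (1 - t) • z + t • u - y = (z - y) + t • (u - z) := by module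
  have hneg : ⟪y - z, u - z⟫ = -⟪z - y, u - z⟫ := by
    rw [← inner_neg_left, neg_sub]
  rw [hsub, norm_add_sq_real, inner_add_right, inner_smul_right, inner_smul_right, norm_smul,
    Real.norm_of_nonneg ht.le] at hw
  rw [hneg]
  have hscaled := mul_le_mul_of_nonneg_left hw hlam.le
  have hcancel : ∀ x : ℝ, lam * (1 / (2 * lam) * x) = x / 2 := fun x => by field_simp
  simp only [mul_add, hcancel] at hscaled
  linarith

/-- Proposition 2.7 of the paper. One step of the composite gradient
method is an instance of the GIPP framework: with `ṽ_k = z_{k−1} − z_k` and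
`ε̃_k = λ[g(z_k) − ℓ_g(z_k;z_{k−1}) + ‖z_k − z_{k−1}‖²/(2λ)]`, one has `ε̃_k ≥ 0`, the
inclusion `ṽ_k ∈ ∂_{ε̃_k}(λ(g + h) + ‖· − z_{k−1}‖²/2)(z_k)`, and the relative error
condition with `σ = (λM + 2)/4 < 1`. -/
theorem composite_gradient_is_gipp {n : ℕ} (h : EuclideanSpace ℝ (Fin n) → EReal)
    (hproper : ProperFun h) (hlsc : LowerSemicontinuous h) (hconv : ConvexEReal h)
    (g : EuclideanSpace ℝ (Fin n) → ℝ) (Gg : EuclideanSpace ℝ (Fin n) → EuclideanSpace ℝ (Fin n))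
    (m M : ℝ) (hm : 0 < m) (hmM : m ≤ M)
    (hdiff : ∀ x ∈ edom h, HasGradientAt g (Gg x) x)
    (hcurv_lower : ∀ zt ∈ edom h, ∀ u ∈ edom h,
      -(m / 2) * ‖u - zt‖ ^ 2 ≤ g u - (g zt + ⟪Gg zt, u - zt⟫))
    (hcurv_upper : ∀ zt ∈ edom h, ∀ u ∈ edom h,
      g u - (g zt + ⟪Gg zt, u - zt⟫) ≤ M / 2 * ‖u - zt‖ ^ 2)
    (lam : ℝ) (hlam0 : 0 < lam) (hlam1 : lam ≤ 1 / m) (hlam2 : lam < 2 / M)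
    (zkm : EuclideanSpace ℝ (Fin n)) (hzkm : zkm ∈ edom h)
    (zk : EuclideanSpace ℝ (Fin n))
    (hzk : ∀ u : EuclideanSpace ℝ (Fin n),
      ((g zkm + ⟪Gg zkm, zk - zkm⟫ + 1 / (2 * lam) * ‖zk - zkm‖ ^ 2 : ℝ) : EReal) + h zk
        ≤ ((g zkm + ⟪Gg zkm, u - zkm⟫ + 1 / (2 * lam) * ‖u - zkm‖ ^ 2 : ℝ) : EReal) + h u)
    (vt : EuclideanSpace ℝ (Fin n)) (hvt : vt = zkm - zk)
    (epst : ℝ)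
    (hepst : epst = lam *
      (g zk - (g zkm + ⟪Gg zkm, zk - zkm⟫) + 1 / (2 * lam) * ‖zk - zkm‖ ^ 2)) :
    0 ≤ epst ∧
    vt ∈ epsSubdiff
      (fun u => (lam : EReal) * (((g u : ℝ) : EReal) + h u)
        + (((1 : ℝ) / 2 * ‖u - zkm‖ ^ 2 : ℝ) : EReal)) ((epst : ℝ) : EReal) zk ∧
    ‖vt‖ ^ 2 + 2 * epst ≤ (lam * M + 2) / 4 * ‖zkm - zk + vt‖ ^ 2 ∧
    (lam * M + 2) / 4 < 1 := by
  have hM : 0 < M := hm.trans_le hmM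
  have hlm : lam * m ≤ 1 := (le_div_iff₀ hm).1 hlam1
  have hlM : lam * M < 2 := (lt_div_iff₀ hM).1 hlam2
  have hzk_dom : zk ∈ edom h := by
    intro htop
    have := hzk zkm
    rw [htop, EReal.coe_add_top, top_le_iff] at this
    exact EReal.add_ne_top (EReal.coe_ne_top _) hzkm this
  have heps : epst = lam * (g zk - (g zkm + ⟪Gg zkm, zk - zkm⟫)) + ‖zk - zkm‖ ^ 2 / 2 := by
    rw [hepst]
    field_simp
  have hlower : ∀ u ∈ edom h,
      0 ≤ lam * (g u - (g zkm + ⟪Gg zkm, u - zkm⟫)) + ‖u - zkm‖ ^ 2 / 2 := by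
    intro u hu
    have h1 := mul_le_mul_of_nonneg_left (hcurv_lower zkm hzkm u hu) hlam0.le
    have h2 := mul_le_mul_of_nonneg_right hlm (sq_nonneg ‖u - zkm‖)
    linarith
  refine ⟨heps ▸ hlower zk hzk_dom, ?_, ?_, by linarith⟩
  · intro u
    beta_reduce
    by_cases hu : h u = ⊤
    · rw [hu, EReal.coe_add_top, EReal.coe_mul_top_of_pos hlam0, EReal.top_add_coe]
      exact le_top
    have hopt := prox_step_optimality hproper.1 hconv hlam0 hzk_dom hu hzk
    have hsplit : ⟪Gg zkm, u - zkm⟫ = ⟪Gg zkm, u - zk⟫ + ⟪Gg zkm, zk - zkm⟫ := by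
      rw [← inner_add_right, sub_add_sub_cancel]
    have hlow := hlower u hu
    rw [hsplit] at hlow
    rw [← EReal.coe_toReal hzk_dom (hproper.1 zk), ← EReal.coe_toReal hu (hproper.1 u)]
    norm_cast
    rw [heps, hvt]
    linarith
  · have hup := mul_le_mul_of_nonneg_left (hcurv_upper zkm hzkm zk hzk_dom) hlam0.le
    have hdouble : zkm - zk + vt = (2 : ℝ) • vt := by
      rw [hvt]
      module
    rw [hdouble, norm_smul, Real.norm_ofNat, hvt, norm_sub_rev zkm zk, heps]
    linarith
end
end

section
/- Let h : ℝ^n → (−∞,∞] be proper lower semicontinuous convex and let g be differentiable on dom h with g(u) − ℓ_g(u;z) ≤ (M/2)‖u−z‖² for all z,u ∈ dom h, where M > 0. Let (ρ̄, ε̄) ∈ ℝ_{++}², and let (λ, z⁻, z, w, ε) ∈ ℝ_{++} × ℝ^n × ℝ^n × ℝ^n × ℝ_+ satisfy w ∈ ∂_ε( g + h + (1/(2λ))‖·−z⁻‖² )(z), ‖(1/λ)(z⁻−z) + w‖ ≤ ρ̄, and ε ≤ ε̄. Define z_g as a minimizer over ℝ^n of u ↦ ℓ_g(u; z) + h(u)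 + ((M+1/λ)/2)‖u−z‖² and q_g := (M+1/λ)(z − z_g). Then q_g ∈ ∇g(z) + ∂h(z_g) and (M+1/λ)‖z−z_g‖ = ‖q_g‖ ≤ ρ̄ + √(2 ε̄ (M+1/λ)). -/
open RealInnerProductSpace

noncomputable section

theorem nonneg_of_forall_linear_add_quadratic_nonneg {A B : ℝ} (hB : 0 ≤ B)
    (H : ∀ t : ℝ, 0 < t → t ≤ 1 → 0 ≤ t * A + t ^ 2 * B) : 0 ≤ A := by
  by_contra! hA
  have hBA : 0 < B - A := by linarith
  have ht : 0 < -A / (B - A) := div_pos (by linarith) hBA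
  have h1 := H (-A / (B - A)) ht (by rw [div_le_one hBA]; linarith)
  have h2 : -A / (B - A) * A + (-A / (B - A)) ^ 2 * B = -A / (B - A) * (-A ^ 2 / (B - A)) := by
    field_simp
    ring
  have h3 : -A ^ 2 / (B - A) < 0 := div_neg_of_neg_of_pos (by nlinarith) hBA
  nlinarith

/-- If `v` is an `ε`-subgradient at `z` of an `L`-strongly convex function along the segment
from `z` to its minimizer, and `q = L‖z − z_g‖`, then `q ≤ ρ + √(2εL)`. -/
theorem le_add_sqrt_of_forall_segment {L q ρ ε : ℝ} (hρ : 0 < ρ)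
    (H : ∀ t : ℝ, 0 ≤ t → t ≤ 1 → t * q * (q * (2 - t) / 2 - ρ) ≤ ε * L) :
    q ≤ ρ + √(2 * ε * L) := by
  rcases le_or_gt q ρ with hq | hq
  · linarith [Real.sqrt_nonneg (2 * ε * L)]
  · have hq0 : 0 < q := hρ.trans hq
    have h1 := H (1 - ρ / q) (by rw [sub_nonneg, div_le_one hq0]; exact hq.le)
      (by linarith [div_pos hρ hq0])
    have h2 : (1 - ρ / q) * q * (q * (2 - (1 - ρ / q)) / 2 - ρ) = (q - ρ) ^ 2 / 2 := by
      field_simp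
      ring
    have h3 : q - ρ ≤ √(2 * ε * L) := Real.le_sqrt_of_sq_le (by linarith)
    linarith

theorem ConvexEReal.toReal_le {n : ℕ} {h : EuclideanSpace ℝ (Fin n) → EReal}
    (hbot : ∀ x, h x ≠ ⊥) (hconv : ConvexEReal h) {x y : EuclideanSpace ℝ (Fin n)}
    (hx : x ∈ edom h) (hy : y ∈ edom h) {t : ℝ} (ht0 : 0 ≤ t) (ht1 : t ≤ 1) :
    x + t • (y - x) ∈ edom h ∧
      (h (x + t • (y - x))).toReal ≤ (1 - t) * (h x).toReal + t * (h y).toReal := by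
  have key := hconv x y (1 - t) t (by linarith) ht0 (by ring)
  rw [show (1 - t) • x + t • y = x + t • (y - x) by module, ← EReal.coe_toReal hx (hbot x),
    ← EReal.coe_toReal hy (hbot y), ← EReal.coe_mul, ← EReal.coe_mul, ← EReal.coe_add] at key
  have hmem : h (x + t • (y - x)) ≠ ⊤ := ne_top_of_le_ne_top (EReal.coe_ne_top _) key
  refine ⟨hmem, ?_⟩
  rw [← EReal.coe_toReal hmem (hbot _)] at key
  exact_mod_cast key

/-- Proposition 2.1(a) of the paper. From a `(ρ̄,ε̄)`-prox-approximate
solution, the composite gradient step point `z_g` and `q_g = (M + 1/λ)(z − z_g)` satisfy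
`q_g ∈ ∇g(z) + ∂h(z_g)` and `(M + 1/λ)‖z − z_g‖ = ‖q_g‖ ≤ ρ̄ + √(2ε̄(M + 1/λ))`. -/
theorem prox_refinement_a {n : ℕ} (h : EuclideanSpace ℝ (Fin n) → EReal)
    (hproper : ProperFun h) (hlsc : LowerSemicontinuous h) (hconv : ConvexEReal h)
    (g : EuclideanSpace ℝ (Fin n) → ℝ) (Gg : EuclideanSpace ℝ (Fin n) → EuclideanSpace ℝ (Fin n))
    (M : ℝ) (hM : 0 < M)
    (hdiff : ∀ x ∈ edom h, HasGradientAt g (Gg x) x)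
    (hcurv : ∀ zt ∈ edom h, ∀ u ∈ edom h,
      g u - (g zt + ⟪Gg zt, u - zt⟫) ≤ M / 2 * ‖u - zt‖ ^ 2)
    (ρbar εbar : ℝ) (hρbar : 0 < ρbar) (hεbar : 0 < εbar)
    (lam : ℝ) (hlam : 0 < lam)
    (zm z w : EuclideanSpace ℝ (Fin n)) (ε : ℝ) (hε0 : 0 ≤ ε)
    (hw : w ∈ epsSubdiff
      (fun u => ((g u + 1 / (2 * lam) * ‖u - zm‖ ^ 2 : ℝ) : EReal) + h u) ((ε : ℝ) : EReal) z)
    (hρ : ‖(1 / lam) • (zm - z) + w‖ ≤ ρbar) (hεε : ε ≤ εbar)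
    (zg : EuclideanSpace ℝ (Fin n))
    (hzg : ∀ u : EuclideanSpace ℝ (Fin n),
      ((g z + ⟪Gg z, zg - z⟫ + (M + 1 / lam) / 2 * ‖zg - z‖ ^ 2 : ℝ) : EReal) + h zg
        ≤ ((g z + ⟪Gg z, u - z⟫ + (M + 1 / lam) / 2 * ‖u - z‖ ^ 2 : ℝ) : EReal) + h u)
    (qg : EuclideanSpace ℝ (Fin n)) (hqg : qg = (M + 1 / lam) • (z - zg)) :
    qg - Gg z ∈ epsSubdiff h (0 : EReal) zg ∧
    (M + 1 / lam) * ‖z - zg‖ = ‖qg‖ ∧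
    ‖qg‖ ≤ ρbar + Real.sqrt (2 * εbar * (M + 1 / lam)) := by
  obtain ⟨hbot, x₀, hx₀⟩ := hproper
  have hL : 0 < M + 1 / lam := by positivity
  have hcoe : ∀ x ∈ edom h, h x = ((h x).toReal : EReal) := fun x hx =>
    (EReal.coe_toReal hx (hbot x)).symm
  have hz : z ∈ edom h := by
    intro htop
    have h1 := hw x₀
    simp only [htop, EReal.coe_add_top, EReal.top_add_coe, EReal.top_sub_coe] at h1
    rw [hcoe x₀ hx₀, ← EReal.coe_add] at h1
    exact EReal.coe_ne_top _ (top_le_iff.mp h1)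
  have hzg' : zg ∈ edom h := by
    intro htop
    have h1 := hzg x₀
    rw [htop, EReal.coe_add_top, hcoe x₀ hx₀, ← EReal.coe_add] at h1
    exact EReal.coe_ne_top _ (top_le_iff.mp h1)
  have hmin : ∀ u ∈ edom h,
      ⟪Gg z, zg - z⟫ + (M + 1 / lam) / 2 * ‖zg - z‖ ^ 2 + (h zg).toReal
        ≤ ⟪Gg z, u - z⟫ + (M + 1 / lam) / 2 * ‖u - z‖ ^ 2 + (h u).toReal := by
    intro u hu
    have h1 := hzg u
    rw [hcoe u hu, hcoe zg hzg', ← EReal.coe_add, ← EReal.coe_add, EReal.coe_le_coe_iff] at h1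
    linarith
  have hsub : ∀ u ∈ edom h, (h zg).toReal + ⟪qg - Gg z, u - zg⟫ ≤ (h u).toReal := by
    intro u hu
    have hA : 0 ≤ (h u).toReal - (h zg).toReal - ⟪qg - Gg z, u - zg⟫ := by
      refine nonneg_of_forall_linear_add_quadratic_nonneg
        (B := (M + 1 / lam) / 2 * ‖u - zg‖ ^ 2) (by positivity) fun t ht0 ht1 => ?_
      obtain ⟨hmem, hc⟩ := hconv.toReal_le hbot hzg' hu ht0.le ht1
      have h1 := hmin _ hmem
      rw [show zg + t • (u - zg) - z = (zg - z) + t • (u - zg) by abel, norm_add_sq_real,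
        inner_add_right, inner_smul_right, inner_smul_right, norm_smul, mul_pow,
        Real.norm_eq_abs, sq_abs] at h1
      rw [hqg, inner_sub_left, real_inner_smul_left, ← neg_sub zg z, inner_neg_left]
      linarith
    linarith
  have hw' : ∀ u ∈ edom h,
      g z + 1 / (2 * lam) * ‖z - zm‖ ^ 2 + (h z).toReal + ⟪w, u - z⟫ - ε
        ≤ g u + 1 / (2 * lam) * ‖u - zm‖ ^ 2 + (h u).toReal := by
    intro u hu
    have h1 := hw u
    simp only at h1
    rw [hcoe u hu, hcoe z hz] at h1
    exact_mod_cast h1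
  have hnorm : (M + 1 / lam) * ‖z - zg‖ = ‖qg‖ := by
    rw [hqg, norm_smul, Real.norm_of_nonneg hL.le]
  refine ⟨fun u => ?_, hnorm, ?_⟩
  · by_cases hu : h u = ⊤
    · rw [hu]
      exact le_top
    · rw [hcoe u hu, hcoe zg hzg', sub_zero, ← EReal.coe_add, EReal.coe_le_coe_iff]
      exact hsub u hu
  · refine le_add_sqrt_of_forall_segment hρbar fun t ht0 ht1 => ?_
    obtain ⟨hmem, hc⟩ := hconv.toReal_le hbot hz hzg' ht0 ht1
    have h1 := hw' _ hmem
    have h2 := hcurv z hz _ hmem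
    have h3 := hsub z hz
    rw [show z + t • (zg - z) - zm = (z - zm) + t • (zg - z) by abel, norm_add_sq_real] at h1
    rw [add_sub_cancel_left, inner_smul_right, norm_smul, mul_pow, Real.norm_eq_abs, sq_abs]
      at h1 h2
    rw [inner_smul_right] at h1
    rw [hqg, inner_sub_left, real_inner_smul_left, real_inner_self_eq_norm_sq,
      ← neg_sub zg z, inner_neg_right, norm_neg] at h3
    have h4 : -(ρbar * ‖zg - z‖) ≤ ⟪(1 / lam) • (zm - z) + w, zg - z⟫ :=
      (abs_le.mp ((abs_real_inner_le_norm _ _).trans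
        (mul_le_mul_of_nonneg_right hρ (norm_nonneg _)))).1
    rw [inner_add_left, real_inner_smul_left, ← neg_sub z zm, inner_neg_left] at h4
    rw [← hnorm, norm_sub_rev z zg]
    have h5 := mul_le_mul_of_nonneg_left h3 ht0
    have h6 := mul_le_mul_of_nonneg_left h4 ht0
    rw [show 1 / (2 * lam) = 1 / lam / 2 by field_simp] at h1
    have h7 : t * ‖zg - z‖ * ((M + 1 / lam) * ‖zg - z‖ * (2 - t) / 2 - ρbar) ≤ εbar := by
      linarith
    have h8 := mul_le_mul_of_nonneg_right h7 hL.le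
    linarith
end
end

section
/- Let σ > 0, A > 0 with A ≥ 2(1+√σ)²/σ, let x_0, x, u ∈ ℝ^n, and let η ≥ 0 satisfy ‖A u + x − x_0‖² + 2Aη ≤ ‖x − x_0‖². Then ‖u‖² + 2η ≤ σ‖x_0 − x + u‖². -/
/-- Lemma 3.2 of the paper, key inequality. If
`A ≥ 2(1 + √σ)²/σ` and `‖Au + x − x_0‖² + 2Aη ≤ ‖x − x_0‖²`, then
`‖u‖² + 2η ≤ σ‖x_0 − x + u‖²`. -/
theorem acg_relative_error {n : ℕ} (σ A : ℝ) (hσ : 0 < σ) (hA : 0 < A)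
    (hA2 : 2 * (1 + Real.sqrt σ) ^ 2 / σ ≤ A)
    (x0 x u : EuclideanSpace ℝ (Fin n)) (η : ℝ) (hη : 0 ≤ η)
    (hineq : ‖A • u + x - x0‖ ^ 2 + 2 * A * η ≤ ‖x - x0‖ ^ 2) :
    ‖u‖ ^ 2 + 2 * η ≤ σ * ‖x0 - x + u‖ ^ 2 := by
  have hσA : 2 ≤ A * σ := by
    rw [div_le_iff₀ hσ] at hA2
    nlinarith [Real.sqrt_nonneg σ]
  obtain ⟨w, rfl⟩ : ∃ w, x0 = x + w := ⟨x0 - x, by abel⟩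
  have hAu : A • u + x - (x + w) = A • u - w := by abel
  have hw : x - (x + w) = -w := by abel
  have hwu : x + w - x + u = w + u := by abel
  rw [hAu, hw, norm_neg, norm_sub_sq_real, norm_smul, real_inner_smul_left, mul_pow,
    Real.norm_eq_abs, sq_abs] at hineq
  rw [hwu, norm_add_sq_real, real_inner_comm]
  have hη_le : A * ‖u‖ ^ 2 + 2 * η ≤ 2 * inner ℝ u w := by
    refine le_of_mul_le_mul_left ?_ hA
    linarith
  have hsq : 0 ≤ ‖σ • w + (σ - 1) • u‖ ^ 2 := sq_nonneg _
  rw [norm_add_sq_real, norm_smul, norm_smul, real_inner_smul_left, real_inner_smul_right,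
    mul_pow, mul_pow, Real.norm_eq_abs, Real.norm_eq_abs, sq_abs, sq_abs,
    real_inner_comm] at hsq
  have hu : 0 ≤ (A * σ + σ - 1) * ‖u‖ ^ 2 := mul_nonneg (by linarith) (sq_nonneg _)
  have hquad : 0 ≤ σ * ‖w‖ ^ 2 + 2 * (σ - 1) * inner ℝ u w + (σ + A - 1) * ‖u‖ ^ 2 := by
    refine nonneg_of_mul_nonneg_right ?_ hσ
    linarith
  linarith
end

section
/- Let ψ : ℝ^n → (−∞,∞] be proper and μ-strongly convex with μ > 0, and let x* be its (unique) minimizer. Let x_0 ∈ ℝ^n, and suppose x_j, x_i ∈ ℝ^n and A_j, A_i > 0 satisfy ψ(x_j) − ψ(x*) ≤ ‖x*−x_0‖²/(2A_j) and ψ(x_i) − ψ(x*) ≤ ‖x*−x_0‖²/(2A_i). Then (1 − 1/√(A_j μ))‖x*−x_0‖ ≤ ‖x_j−x_0‖ ≤ (1 + 1/√(A_j μ))‖x*−x_0‖; moreover, if A_i μ > 1 then ‖x_j−x_0‖ ≤ [(1 + 1/√(A_j μ))/(1 − 1/√(A_i μ))]·‖x_i−x_0‖. -/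
noncomputable section

/-- `μ`-strong convexity of an extended-real-valued function:
`ψ(αz + (1−α)u) ≤ αψ(z) + (1−α)ψ(u) − (α(1−α)μ/2)‖z − u‖²`. -/
def StronglyConvexEReal {n : ℕ} (μ : ℝ) (ψ : EuclideanSpace ℝ (Fin n) → EReal) : Prop :=
  ∀ x y : EuclideanSpace ℝ (Fin n), ∀ α β : ℝ, 0 ≤ α → 0 ≤ β → α + β = 1 →
    ψ (α • x + β • y)
      ≤ (α : EReal) * ψ x + (β : EReal) * ψ y - ((α * β * (μ / 2) * ‖x - y‖ ^ 2 : ℝ) : EReal)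

/-- A proper strongly convex function grows quadratically away from its minimizer. -/
theorem StronglyConvexEReal.sq_dist_le_of_sub_le {n : ℕ} {ψ : EuclideanSpace ℝ (Fin n) → EReal}
    (hproper : ProperFun ψ) {μ : ℝ} (hsc : StronglyConvexEReal μ ψ)
    {xstar : EuclideanSpace ℝ (Fin n)} (hmin : ∀ u, ψ xstar ≤ ψ u)
    {x : EuclideanSpace ℝ (Fin n)} {r : ℝ} (hx : ψ x - ψ xstar ≤ (r : EReal)) :
    μ / 2 * ‖x - xstar‖ ^ 2 ≤ r := by
  obtain ⟨hbot, y, hy⟩ := hproper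
  have hstar : ψ xstar ≠ ⊤ := fun h => hy (top_le_iff.mp (h ▸ hmin y))
  obtain ⟨p, hp⟩ : ∃ p : ℝ, ψ xstar = p := ⟨_, (EReal.coe_toReal hstar (hbot _)).symm⟩
  have hxtop : ψ x ≠ ⊤ := by
    intro h
    rw [h, hp, EReal.top_sub_coe, top_le_iff] at hx
    exact EReal.coe_ne_top r hx
  obtain ⟨a, ha⟩ : ∃ a : ℝ, ψ x = a := ⟨_, (EReal.coe_toReal hxtop (hbot _)).symm⟩
  have har : a - p ≤ r := by
    rw [ha, hp] at hx
    exact_mod_cast hx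
  have hpa : p ≤ a := by
    have h := hmin x
    rw [ha, hp] at h
    exact_mod_cast h
  set c := μ / 2 * ‖x - xstar‖ ^ 2 with hc
  have key : ∀ t : ℝ, 0 < t → t ≤ 1 → (1 - t) * c ≤ a - p := by
    intro t ht ht1
    have h := (hmin _).trans (hsc x xstar t (1 - t) ht.le (by linarith) (by ring))
    rw [ha, hp] at h
    have h' : p ≤ t * a + (1 - t) * p - t * (1 - t) * (μ / 2) * ‖x - xstar‖ ^ 2 := by
      exact_mod_cast h
    refine le_of_mul_le_mul_left ?_ ht
    rw [hc]
    linarith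
  refine le_trans ?_ har
  by_contra! hlt
  have hcpos : 0 < c := by linarith
  have h := key ((c - (a - p)) / (2 * c)) (div_pos (by linarith) (by linarith))
    ((div_le_one (by linarith)).mpr (by linarith))
  have h2 : (1 - (c - (a - p)) / (2 * c)) * c = (c + (a - p)) / 2 := by
    field_simp
    ring
  linarith

/-- A gap of at most `D ^ 2 / (2 * A)` in function value puts a point within `D / √(A * μ)` of the
minimizer. -/
theorem StronglyConvexEReal.dist_le_of_sub_le {n : ℕ} {ψ : EuclideanSpace ℝ (Fin n) → EReal}
    (hproper : ProperFun ψ) {μ : ℝ} (hμ : 0 < μ) (hsc : StronglyConvexEReal μ ψ)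
    {xstar : EuclideanSpace ℝ (Fin n)} (hmin : ∀ u, ψ xstar ≤ ψ u)
    {x : EuclideanSpace ℝ (Fin n)} {A D : ℝ} (hA : 0 < A) (hD : 0 ≤ D)
    (hx : ψ x - ψ xstar ≤ ((D ^ 2 / (2 * A) : ℝ) : EReal)) :
    ‖x - xstar‖ ≤ 1 / Real.sqrt (A * μ) * D := by
  have h := hsc.sq_dist_le_of_sub_le hproper hmin hx
  refine (sq_le_sq₀ (norm_nonneg _) (by positivity)).mp ?_
  rw [mul_pow, div_pow, Real.sq_sqrt (by positivity), one_pow, one_div_mul_eq_div,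
    le_div_iff₀ (by positivity)]
  rw [le_div_iff₀ (by positivity)] at h
  linarith

/-- Lemma 3.3 of the paper. For a proper `μ`-strongly convex `ψ` with
minimizer `x*`, iterates satisfying `ψ(x_j) − ψ(x*) ≤ ‖x* − x_0‖²/(2A_j)` obey
`(1 − 1/√(A_jμ))‖x* − x_0‖ ≤ ‖x_j − x_0‖ ≤ (1 + 1/√(A_jμ))‖x* − x_0‖`, and consequently,
if `A_iμ > 1`, `‖x_j − x_0‖ ≤ ((1 + 1/√(A_jμ))/(1 − 1/√(A_iμ)))‖x_i − x_0‖`. -/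
theorem acg_distance_estimates {n : ℕ} (ψ : EuclideanSpace ℝ (Fin n) → EReal)
    (hproper : ProperFun ψ) (μ : ℝ) (hμ : 0 < μ) (hsc : StronglyConvexEReal μ ψ)
    (xstar : EuclideanSpace ℝ (Fin n)) (hmin : ∀ u, ψ xstar ≤ ψ u)
    (x0 xj xi : EuclideanSpace ℝ (Fin n)) (Aj Ai : ℝ) (hAj : 0 < Aj) (hAi : 0 < Ai)
    (hj : ψ xj - ψ xstar ≤ ((‖xstar - x0‖ ^ 2 / (2 * Aj) : ℝ) : EReal))
    (hi : ψ xi - ψ xstar ≤ ((‖xstar - x0‖ ^ 2 / (2 * Ai) : ℝ) : EReal)) :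
    ((1 - 1 / Real.sqrt (Aj * μ)) * ‖xstar - x0‖ ≤ ‖xj - x0‖ ∧
      ‖xj - x0‖ ≤ (1 + 1 / Real.sqrt (Aj * μ)) * ‖xstar - x0‖) ∧
    (1 < Ai * μ →
      ‖xj - x0‖ ≤ (1 + 1 / Real.sqrt (Aj * μ)) / (1 - 1 / Real.sqrt (Ai * μ)) * ‖xi - x0‖) := by
  have bj := hsc.dist_le_of_sub_le hproper hμ hmin hAj (norm_nonneg _) hj
  have bi := hsc.dist_le_of_sub_le hproper hμ hmin hAi (norm_nonneg _) hi
  have lower (x : EuclideanSpace ℝ (Fin n)) : ‖xstar - x0‖ ≤ ‖x - xstar‖ + ‖x - x0‖ := by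
    rw [norm_sub_rev x xstar]
    exact norm_sub_le_norm_sub_add_norm_sub _ _ _
  have upper : ‖xj - x0‖ ≤ (1 + 1 / Real.sqrt (Aj * μ)) * ‖xstar - x0‖ := by
    linarith [norm_sub_le_norm_sub_add_norm_sub xj xstar x0]
  refine ⟨⟨by linarith [lower xj], upper⟩, fun h => ?_⟩
  have hs : 0 < 1 - 1 / Real.sqrt (Ai * μ) := by
    have h1 : 1 < Real.sqrt (Ai * μ) := Real.lt_sqrt_of_sq_lt (by linarith)
    rw [sub_pos, div_lt_one (by linarith)]
    exact h1
  have hD : ‖xstar - x0‖ ≤ ‖xi - x0‖ / (1 - 1 / Real.sqrt (Ai * μ)) := by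
    rw [le_div_iff₀ hs]
    linarith [lower xi]
  calc ‖xj - x0‖ ≤ (1 + 1 / Real.sqrt (Aj * μ)) * ‖xstar - x0‖ := upper
    _ ≤ (1 + 1 / Real.sqrt (Aj * μ)) * (‖xi - x0‖ / (1 - 1 / Real.sqrt (Ai * μ))) := by gcongr
    _ = _ := by ring
end
end

section
/- Let ψ : ℝ^n → (−∞,∞] be proper and μ-strongly convex with μ > 0, with minimizer x*, and let x_0 ∈ ℝ^n. Suppose A_j ≥ A_i ≥ max{8, 9/μ}, and suppose (x_i, u_i, η_i) and (x_j, u_j, η_j) ∈ ℝ^n × ℝ^n × ℝ_+ satisfy, for k ∈ {i,j}: ψ(x_k) − ψ(x*) ≤ ‖x*−x_0‖²/(2A_k) and ‖A_k u_k + x_k − x_0‖² + 2A_k η_k ≤ ‖x_k − x_0‖². Then: (1) ‖x_j−x_0‖ ≤ 2‖x_i−x_0‖; (2) ‖u_j‖ ≤ (4/A_j)‖x_i−x_0‖; (3) η_j ≤ (2/A_j)‖x_i−x_0‖²; (4) ‖x_0−x_j+u_j‖ ≤ (4 + 8/A_j)‖x_0−x_i+u_i‖; (5) η_j ≤ 8‖x_0−x_i+u_i‖²/A_j.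 -/
open RealInnerProductSpace

noncomputable section

/-- A strongly convex function grows quadratically away from its minimizer. -/
theorem quadratic_growth_of_stronglyConvexEReal {n : ℕ} {ψ : EuclideanSpace ℝ (Fin n) → EReal}
    (hproper : ProperFun ψ) {μ : ℝ} (hsc : StronglyConvexEReal μ ψ)
    {z : EuclideanSpace ℝ (Fin n)} (hmin : ∀ u, ψ z ≤ ψ u)
    {x : EuclideanSpace ℝ (Fin n)} {c : ℝ} (hx : ψ x - ψ z ≤ (c : EReal)) :
    μ / 2 * ‖x - z‖ ^ 2 ≤ c := by
  obtain ⟨hbot, w, hw⟩ := hproper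
  have hz : ψ z ≠ ⊤ := ((hmin w).trans_lt (lt_top_iff_ne_top.mpr hw)).ne
  obtain ⟨m, hm⟩ : ∃ m : ℝ, (m : EReal) = ψ z := ⟨_, EReal.coe_toReal hz (hbot z)⟩
  have hxtop : ψ x ≠ ⊤ := by
    intro h
    rw [h, ← hm, EReal.top_sub_coe] at hx
    exact EReal.coe_ne_top c (top_le_iff.mp hx)
  obtain ⟨p, hp⟩ : ∃ p : ℝ, (p : EReal) = ψ x := ⟨_, EReal.coe_toReal hxtop (hbot x)⟩
  have hpm : p - m ≤ c := by
    rw [← hp, ← hm] at hx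
    exact_mod_cast hx
  have key : ∀ β : ℝ, 0 < β → β < 1 → β * (μ / 2 * ‖x - z‖ ^ 2) ≤ c := by
    intro β h0 h1
    have h := (hmin _).trans (hsc x z (1 - β) β (by linarith) h0.le (by ring))
    rw [← hp, ← hm] at h
    have h' : m ≤ (1 - β) * p + β * m - (1 - β) * β * (μ / 2) * ‖x - z‖ ^ 2 := by
      exact_mod_cast h
    have : β * (μ / 2 * ‖x - z‖ ^ 2) ≤ p - m :=
      le_of_mul_le_mul_left (by linarith) (sub_pos.mpr h1)
    linarith
  have hlim : Filter.Tendsto (fun β : ℝ => β * (μ / 2 * ‖x - z‖ ^ 2)) (nhdsWithin 1 (Set.Iio 1))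
      (nhds (1 * (μ / 2 * ‖x - z‖ ^ 2))) :=
    ((continuous_id.mul continuous_const).tendsto 1).mono_left nhdsWithin_le_nhds
  rw [one_mul] at hlim
  refine le_of_tendsto hlim ?_
  filter_upwards [Ioo_mem_nhdsLT (zero_lt_one' ℝ)] with β hβ using key β hβ.1 hβ.2

/-- A point whose function gap is at most `‖z - x₀‖² / (2A)`, with `A ≥ 9/μ`, is within a third of
`‖z - x₀‖` of the minimizer `z`. -/
theorem three_mul_norm_sub_minimizer_le {n : ℕ} {ψ : EuclideanSpace ℝ (Fin n) → EReal}
    (hproper : ProperFun ψ) {μ : ℝ} (hμ : 0 < μ) (hsc : StronglyConvexEReal μ ψ)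
    {z : EuclideanSpace ℝ (Fin n)} (hmin : ∀ u, ψ z ≤ ψ u)
    {x x0 : EuclideanSpace ℝ (Fin n)} {A : ℝ} (hA : 9 / μ ≤ A)
    (hx : ψ x - ψ z ≤ ((‖z - x0‖ ^ 2 / (2 * A) : ℝ) : EReal)) :
    3 * ‖x - z‖ ≤ ‖z - x0‖ := by
  have hA0 : 0 < A := lt_of_lt_of_le (by positivity) hA
  have hAμ : 9 ≤ A * μ := (div_le_iff₀ hμ).mp hA
  have h := quadratic_growth_of_stronglyConvexEReal hproper hsc hmin hx
  rw [le_div_iff₀ (by positivity)] at h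
  have h9 := mul_le_mul_of_nonneg_right hAμ (sq_nonneg ‖x - z‖)
  exact abs_le_of_sq_le_sq' (by linarith) (norm_nonneg _) |>.2

/-- The norm of `u` is controlled by the residual inequality. -/
theorem mul_norm_le_two_mul_of_residual_le {E : Type*} [NormedAddCommGroup E] [NormedSpace ℝ E]
    {A η : ℝ} {u x x0 : E} (hA : 0 ≤ A) (hη : 0 ≤ η)
    (h : ‖A • u + x - x0‖ ^ 2 + 2 * A * η ≤ ‖x - x0‖ ^ 2) :
    A * ‖u‖ ≤ 2 * ‖x - x0‖ := by
  have hAη := mul_nonneg hA hη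
  have h1 : ‖A • u + x - x0‖ ≤ ‖x - x0‖ := abs_le_of_sq_le_sq' (by linarith) (norm_nonneg _) |>.2
  have h2 : ‖A • u‖ ≤ ‖A • u + x - x0‖ + ‖x - x0‖ := by
    simpa [add_sub_assoc] using norm_sub_le (A • u + x - x0) (x - x0)
  rw [norm_smul, Real.norm_of_nonneg hA] at h2
  linarith

/-- Lemma 3.4 of the paper. Relations between two iterates of the ACG
method: if `A_j ≥ A_i ≥ max{8, 9/μ}` and both iterates satisfy the function-value and
HPE-type estimates, then the five stated inequalities hold. -/
theorem acg_two_iterate_relations {n : ℕ} (ψ : EuclideanSpace ℝ (Fin n) → EReal)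
    (hproper : ProperFun ψ) (μ : ℝ) (hμ : 0 < μ) (hsc : StronglyConvexEReal μ ψ)
    (xstar : EuclideanSpace ℝ (Fin n)) (hmin : ∀ u, ψ xstar ≤ ψ u)
    (x0 : EuclideanSpace ℝ (Fin n)) (Ai Aj : ℝ)
    (hAi : max 8 (9 / μ) ≤ Ai) (hAij : Ai ≤ Aj)
    (xi ui xj uj : EuclideanSpace ℝ (Fin n)) (ηi ηj : ℝ) (hηi : 0 ≤ ηi) (hηj : 0 ≤ ηj)
    (hvali : ψ xi - ψ xstar ≤ ((‖xstar - x0‖ ^ 2 / (2 * Ai) : ℝ) : EReal))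
    (hvalj : ψ xj - ψ xstar ≤ ((‖xstar - x0‖ ^ 2 / (2 * Aj) : ℝ) : EReal))
    (hhpei : ‖Ai • ui + xi - x0‖ ^ 2 + 2 * Ai * ηi ≤ ‖xi - x0‖ ^ 2)
    (hhpej : ‖Aj • uj + xj - x0‖ ^ 2 + 2 * Aj * ηj ≤ ‖xj - x0‖ ^ 2) :
    ‖xj - x0‖ ≤ 2 * ‖xi - x0‖ ∧
    ‖uj‖ ≤ 4 / Aj * ‖xi - x0‖ ∧
    ηj ≤ 2 / Aj * ‖xi - x0‖ ^ 2 ∧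
    ‖x0 - xj + uj‖ ≤ (4 + 8 / Aj) * ‖x0 - xi + ui‖ ∧
    ηj ≤ 8 * ‖x0 - xi + ui‖ ^ 2 / Aj := by
  have hAi8 : 8 ≤ Ai := (le_max_left _ _).trans hAi
  have hAiμ : 9 / μ ≤ Ai := (le_max_right _ _).trans hAi
  have hAi0 : 0 < Ai := by linarith
  have hAj0 : 0 < Aj := by linarith
  have hdi := three_mul_norm_sub_minimizer_le hproper hμ hsc hmin hAiμ hvali
  have hdj := three_mul_norm_sub_minimizer_le hproper hμ hsc hmin (hAiμ.trans hAij) hvalj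
  have hui := mul_norm_le_two_mul_of_residual_le hAi0.le hηi hhpei
  have huj := mul_norm_le_two_mul_of_residual_le hAj0.le hηj hhpej
  have hlow := norm_sub_le_norm_sub_add_norm_sub xstar xi x0
  rw [norm_sub_rev xstar xi] at hlow
  have hup := norm_sub_le_norm_sub_add_norm_sub xj xstar x0
  have h1 : ‖xj - x0‖ ≤ 2 * ‖xi - x0‖ := by linarith
  have h2 : ‖uj‖ ≤ 4 / Aj * ‖xi - x0‖ := by
    rw [div_mul_eq_mul_div, le_div_iff₀ hAj0]
    linarith
  have hηAj : ηj * Aj ≤ 2 * ‖xi - x0‖ ^ 2 := by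
    have := pow_le_pow_left₀ (norm_nonneg _) h1 2
    linarith [sq_nonneg ‖Aj • uj + xj - x0‖]
  have hxi : ‖xi - x0‖ ≤ 2 * ‖x0 - xi + ui‖ := by
    have h8 := mul_le_mul_of_nonneg_right hAi8 (norm_nonneg ui)
    have htri : ‖xi - x0‖ ≤ ‖x0 - xi + ui‖ + ‖ui‖ := by
      simpa [norm_sub_rev] using norm_sub_le (x0 - xi + ui) ui
    linarith [norm_nonneg (x0 - xi + ui)]
  refine ⟨h1, h2, ?_, ?_, ?_⟩
  · rwa [div_mul_eq_mul_div, le_div_iff₀ hAj0]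
  · calc ‖x0 - xj + uj‖ ≤ ‖xj - x0‖ + ‖uj‖ := by
          simpa only [norm_sub_rev x0 xj] using norm_add_le (x0 - xj) uj
      _ ≤ (2 + 4 / Aj) * ‖xi - x0‖ := by linarith
      _ ≤ (2 + 4 / Aj) * (2 * ‖x0 - xi + ui‖) := by gcongr
      _ = (4 + 8 / Aj) * ‖x0 - xi + ui‖ := by ring
  · rw [le_div_iff₀ hAj0]
    have := pow_le_pow_left₀ (norm_nonneg _) hxi 2
    linarith
end
end

section
/- Let h : ℝ^n → (−∞,∞] be proper lower semicontinuous convex, f : ℝ^n → ℝ, A a real l×n matrix, b ∈ ℝ^l, σ ∈ (0,1), z_0 ∈ dom h, and suppose ĉ ≥ 0 satisfies φ̂_ĉ := inf φ_ĉ > −∞ and that F := {z ∈ dom h : Az=b} ≠ ∅, where φ_c := f + h + (c/2)‖A(·)−b‖². Let c > ĉ and let {(λ_k, z_k, ṽ_k, ε̃_k)}_{k≥1} be a GIPP sequence for (φ_c, σ, z_0). Let η̂ > 0 and define T_η̂(λ) := 2 R_ĉ(λ)/(η̂²(1−σ)λ) + ĉ, where R_ĉ(λ) := inf{ (1/2)‖z_0−u‖²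 + (1−σ)λ(φ_ĉ(u) − φ̂_ĉ) : u ∈ F }. Then for every ẑ ∈ ℝ^n with φ_c(ẑ) ≤ φ_c(z_1): ‖Aẑ − b‖² ≤ [T_η̂(λ_1) − ĉ]·η̂²/(c − ĉ). Consequently, if c ≥ T_η̂(λ_1), then ‖A z_k − b‖ ≤ η̂ for every k ≥ 1. -/
open RealInnerProductSpace

noncomputable section

/-- Under the relative error criterion, the proximal inequality at `z` implies the objective gap
bound `(1 - σ) λ (p - q) ≤ ‖z₀ - u‖² / 2`, where `p`, `q` are the objective values at `z`, `u`. -/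
theorem gap_le_of_relative_error {E : Type*} [NormedAddCommGroup E] [InnerProductSpace ℝ E]
    {σ lam p q ε : ℝ} {w z u v : E} (hσ0 : 0 < σ) (hσ1 : σ < 1)
    (herr : ‖v‖ ^ 2 + 2 * ε ≤ σ * ‖w - z + v‖ ^ 2) (hε : 0 ≤ ε)
    (hv : lam * p + 1 / 2 * ‖z - w‖ ^ 2 + ⟪v, u - z⟫ - ε ≤ lam * q + 1 / 2 * ‖u - w‖ ^ 2) :
    (1 - σ) * lam * (p - q) ≤ 1 / 2 * ‖w - u‖ ^ 2 := by
  have hr : ‖w - z + v‖ ^ 2 = ‖z - w‖ ^ 2 + 2 * ⟪v, w - z⟫ + ‖v‖ ^ 2 := by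
    rw [norm_add_sq_real, norm_sub_rev w z, real_inner_comm]
  have hin : ⟪v, u - z⟫ = ⟪v, w - z⟫ - ⟪v, w - u⟫ := by
    rw [← inner_sub_right]; congr 1; abel
  have hsq : 0 ≤ ‖(1 - σ) • v - σ • (w - u)‖ ^ 2 := sq_nonneg _
  rw [norm_sub_sq_real, norm_smul, norm_smul, inner_smul_left, inner_smul_right, mul_pow, mul_pow,
    Real.norm_eq_abs, Real.norm_eq_abs, sq_abs, sq_abs, conj_trivial] at hsq
  rw [norm_sub_rev u w, hin] at hv
  have hgap : lam * (p - q) ≤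
      1 / 2 * ‖w - u‖ ^ 2 - (1 - σ) / 2 * ‖w - z + v‖ ^ 2 + ⟪v, w - u⟫ := by
    linarith
  have hvr : (1 - σ) ^ 2 * ‖v‖ ^ 2 ≤ (1 - σ) ^ 2 * (σ * ‖w - z + v‖ ^ 2) := by
    gcongr; linarith
  have hyoung : (1 - σ) * ⟪v, w - u⟫ ≤
      (1 - σ) * ((1 - σ) / 2 * ‖w - z + v‖ ^ 2) + σ / 2 * ‖w - u‖ ^ 2 :=
    le_of_mul_le_mul_left (by nlinarith) hσ0
  have hmul := mul_le_mul_of_nonneg_left hgap (sub_nonneg.2 hσ1.le)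
  linarith

/-- An inexact proximal step started at `w` lands at a point `z` of finite objective value, with
the objective gap controlled by the distance from `w`. -/
theorem exists_coe_eq_and_gap_le {n : ℕ} {ψ : EuclideanSpace ℝ (Fin n) → EReal}
    (hψ : ∀ x, ψ x ≠ ⊥) {σ lam q ε : ℝ} {w z u v : EuclideanSpace ℝ (Fin n)}
    (hσ0 : 0 < σ) (hσ1 : σ < 1) (hlam : 0 < lam) (hε : 0 ≤ ε)
    (herr : ‖v‖ ^ 2 + 2 * ε ≤ σ * ‖w - z + v‖ ^ 2)
    (hv : v ∈ epsSubdiff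
      (fun x => (lam : EReal) * ψ x + (((1 : ℝ) / 2 * ‖x - w‖ ^ 2 : ℝ) : EReal)) (ε : EReal) z)
    (hu : ψ u = (q : EReal)) :
    ∃ p : ℝ, ψ z = (p : EReal) ∧ (1 - σ) * lam * (p - q) ≤ 1 / 2 * ‖w - u‖ ^ 2 := by
  have hvu := hv u
  simp only [hu] at hvu
  have htop : ψ z ≠ ⊤ := by
    intro hz
    rw [hz, EReal.coe_mul_top_of_pos hlam, EReal.top_add_coe, EReal.top_add_coe,
      EReal.top_sub_coe, top_le_iff] at hvu
    exact EReal.coe_ne_top (lam * q + 1 / 2 * ‖u - w‖ ^ 2) (by exact_mod_cast hvu)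
  lift ψ z to ℝ using ⟨htop, hψ z⟩ with p
  exact ⟨p, rfl, gap_le_of_relative_error hσ0 hσ1 herr hε (by exact_mod_cast hvu)⟩

/-- Lemma 4.3 of the paper. Feasibility behavior of a GIPP instance
applied to the quadratic penalty function `φ_c`: any point with value not exceeding
`φ_c(z_1)` satisfies `‖Aẑ − b‖² ≤ (T_η̂(λ_1) − ĉ)η̂²/(c − ĉ)`; consequently, if
`c ≥ T_η̂(λ_1)` then `‖Az_k − b‖ ≤ η̂` for every `k ≥ 1`. -/
theorem penalty_gipp_feasibility {l n : ℕ} (h : EuclideanSpace ℝ (Fin n) → EReal)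
    (hproper : ProperFun h) (hlsc : LowerSemicontinuous h) (hconv : ConvexEReal h)
    (f : EuclideanSpace ℝ (Fin n) → ℝ)
    (A : EuclideanSpace ℝ (Fin n) →L[ℝ] EuclideanSpace ℝ (Fin l))
    (b : EuclideanSpace ℝ (Fin l))
    (σ : ℝ) (hσ0 : 0 < σ) (hσ1 : σ < 1)
    (φc : ℝ → EuclideanSpace ℝ (Fin n) → EReal)
    (hφc : ∀ c u, φc c u = ((f u : ℝ) : EReal) + h u + ((c / 2 * ‖A u - b‖ ^ 2 : ℝ) : EReal))
    (F : Set (EuclideanSpace ℝ (Fin n))) (hF : F = {u | u ∈ edom h ∧ A u = b})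
    (hFne : F.Nonempty)
    (chat : ℝ) (hchat : 0 ≤ chat) (hfin : (⨅ u, φc chat u) ≠ ⊥)
    (c : ℝ) (hc : chat < c)
    (lam : ℕ → ℝ) (z : ℕ → EuclideanSpace ℝ (Fin n))
    (v : ℕ → EuclideanSpace ℝ (Fin n)) (eps : ℕ → ℝ)
    (hz0 : z 0 ∈ edom h)
    (hlam : ∀ k, 1 ≤ k → 0 < lam k) (heps : ∀ k, 1 ≤ k → 0 ≤ eps k)
    (hincl : ∀ k, 1 ≤ k → v k ∈ epsSubdiff
      (fun u => (lam k : EReal) * φc c u + (((1 : ℝ) / 2 * ‖u - z (k - 1)‖ ^ 2 : ℝ) : EReal))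
      ((eps k : ℝ) : EReal) (z k))
    (herr : ∀ k, 1 ≤ k → ‖v k‖ ^ 2 + 2 * eps k ≤ σ * ‖z (k - 1) - z k + v k‖ ^ 2)
    (ηhat : ℝ) (hηhat : 0 < ηhat)
    (Rhat : ℝ → EReal)
    (hRhat : ∀ t : ℝ, Rhat t = ⨅ u ∈ F,
      (((1 : ℝ) / 2 * ‖z 0 - u‖ ^ 2 : ℝ) : EReal)
        + (((1 - σ) * t : ℝ) : EReal) * (φc chat u - ⨅ u', φc chat u'))
    (T : ℝ → EReal)
    (hT : ∀ t : ℝ, T t = 2 * Rhat t / ((ηhat ^ 2 * (1 - σ) * t : ℝ) : EReal) + (chat : EReal)) :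
    (∀ zhat : EuclideanSpace ℝ (Fin n), φc c zhat ≤ φc c (z 1) →
      ((‖A zhat - b‖ ^ 2 : ℝ) : EReal)
        ≤ (T (lam 1) - (chat : EReal)) * ((ηhat ^ 2 : ℝ) : EReal) / (((c - chat : ℝ)) : EReal)) ∧
    (T (lam 1) ≤ (c : EReal) → ∀ k, 1 ≤ k → ‖A (z k) - b‖ ≤ ηhat) := by
  have hbot : ∀ c u, φc c u ≠ ⊥ := by
    intro c u
    rw [hφc]
    simp only [ne_eq, EReal.add_eq_bot_iff, hproper.1 u, EReal.coe_ne_bot, or_self,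
      not_false_eq_true]
  have hval : ∀ u, h u ≠ ⊤ → ∃ s : ℝ, ∀ c, φc c u = ((s + c / 2 * ‖A u - b‖ ^ 2 : ℝ) : EReal) := by
    intro u hu
    obtain ⟨t, ht⟩ : ∃ t : ℝ, h u = t := ⟨_, (EReal.coe_toReal hu (hproper.1 u)).symm⟩
    exact ⟨f u + t, fun c => by rw [hφc, ht]; push_cast; rfl⟩
  have hdom : ∀ c u, φc c u ≠ ⊤ → h u ≠ ⊤ := by
    intro c u hu hh
    apply hu
    rw [hφc, hh, EReal.coe_add_top, EReal.top_add_coe]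
  subst hF
  obtain ⟨u₀, hu₀, hAu₀⟩ := hFne
  have hinf_top : (⨅ u, φc chat u) ≠ ⊤ := by
    obtain ⟨s, hs⟩ := hval u₀ hu₀
    exact ne_top_of_le_ne_top (by rw [hs]; exact EReal.coe_ne_top _) (iInf_le _ u₀)
  obtain ⟨m, hm⟩ : ∃ m : ℝ, (⨅ u, φc chat u) = m := ⟨_, (EReal.coe_toReal hinf_top hfin).symm⟩
  have hlam1 := hlam 1 le_rfl
  have hσ' : 0 < 1 - σ := sub_pos.2 hσ1
  have hcc : 0 < c - chat := sub_pos.2 hc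
  have hfeas : ∀ u, h u ≠ ⊤ → A u = b → ∃ q : ℝ, ∀ c, φc c u = q := by
    intro u hu hAu
    obtain ⟨s, hs⟩ := hval u hu
    exact ⟨s, fun c => by simp [hs, hAu]⟩
  have hRbound : ∀ x, φc c x ≤ φc c (z 1) →
      (((1 - σ) * lam 1 * ((c - chat) / 2 * ‖A x - b‖ ^ 2) : ℝ) : EReal) ≤ Rhat (lam 1) := by
    intro x hx
    rw [hRhat]
    refine le_iInf₂ fun u hu => ?_
    obtain ⟨q, hq⟩ := hfeas u hu.1 hu.2
    obtain ⟨p, hp, hgap⟩ := exists_coe_eq_and_gap_le (hbot c) hσ0 hσ1 hlam1 (heps 1 le_rfl)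
      (herr 1 le_rfl) (hincl 1 le_rfl) (hq c)
    obtain ⟨s, hs⟩ := hval x (hdom c x (ne_top_of_le_ne_top (by simp [hp]) hx))
    have hmx : (⨅ u, φc chat u) ≤ φc chat x := iInf_le _ x
    rw [hm, hs, EReal.coe_le_coe_iff] at hmx
    rw [hs, hp, EReal.coe_le_coe_iff] at hx
    rw [hm, hq]
    norm_cast
    have hle : (c - chat) / 2 * ‖A x - b‖ ^ 2 ≤ p - m := by linarith
    have := mul_le_mul_of_nonneg_left hle (mul_pos hσ' hlam1).le
    simp only [Nat.sub_self] at hgap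
    linarith
  have hRbot : Rhat (lam 1) ≠ ⊥ :=
    ne_bot_of_le_ne_bot (EReal.coe_ne_bot _) (hRbound (z 1) le_rfl)
  have hRtop : Rhat (lam 1) ≠ ⊤ := by
    obtain ⟨q, hq⟩ := hfeas u₀ hu₀ hAu₀
    rw [hRhat]
    refine ne_top_of_le_ne_top ?_ (iInf₂_le u₀ ⟨hu₀, hAu₀⟩)
    rw [hm, hq]
    exact_mod_cast EReal.coe_ne_top (1 / 2 * ‖z 0 - u₀‖ ^ (2 : ℕ) + (1 - σ) * lam 1 * (q - m))
  obtain ⟨r, hr⟩ : ∃ r : ℝ, Rhat (lam 1) = r := ⟨_, (EReal.coe_toReal hRtop hRbot).symm⟩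
  have hTr : T (lam 1) = ((2 * r / (ηhat ^ 2 * (1 - σ) * lam 1) + chat : ℝ) : EReal) := by
    rw [hT, hr]
    push_cast
    rfl
  have hbound : ∀ x, φc c x ≤ φc c (z 1) →
      ‖A x - b‖ ^ 2 ≤
        (2 * r / (ηhat ^ 2 * (1 - σ) * lam 1) + chat - chat) * ηhat ^ 2 / (c - chat) := by
    intro x hx
    have hx' := hRbound x hx
    rw [hr, EReal.coe_le_coe_iff] at hx'
    have hrw : (2 * r / (ηhat ^ 2 * (1 - σ) * lam 1) + chat - chat) * ηhat ^ 2 / (c - chat) =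
        2 * r / ((1 - σ) * lam 1 * (c - chat)) := by
      rw [add_sub_cancel_right]
      field_simp
    rw [hrw, le_div_iff₀ (by positivity)]
    linarith
  refine ⟨fun x hx => ?_, fun hTc k hk => ?_⟩
  · rw [hTr, ← EReal.coe_sub, ← EReal.coe_mul, ← EReal.coe_div, EReal.coe_le_coe_iff]
    exact hbound x hx
  · have hdescent : (∃ p : ℝ, φc c (z k) = p) ∧ φc c (z k) ≤ φc c (z 1) := by
      induction k, hk using Nat.le_induction with
      | base =>
        obtain ⟨q, hq⟩ := hfeas u₀ hu₀ hAu₀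
        obtain ⟨p, hp, -⟩ := exists_coe_eq_and_gap_le (hbot c) hσ0 hσ1 hlam1 (heps 1 le_rfl)
          (herr 1 le_rfl) (hincl 1 le_rfl) (hq c)
        exact ⟨⟨p, hp⟩, le_rfl⟩
      | succ k hk ih =>
        obtain ⟨⟨q, hq⟩, hle⟩ := ih
        have hk' : 1 ≤ k + 1 := Nat.le_add_left 1 k
        obtain ⟨p, hp, hgap⟩ := exists_coe_eq_and_gap_le (u := z k) (hbot c) hσ0 hσ1
          (hlam _ hk') (heps _ hk') (herr _ hk') (hincl _ hk') hq
        refine ⟨⟨p, hp⟩, le_trans ?_ hle⟩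
        rw [hp, hq, EReal.coe_le_coe_iff]
        have hpos : 0 < (1 - σ) * lam (k + 1) := mul_pos hσ' (hlam _ hk')
        simp only [Nat.add_sub_cancel, sub_self, norm_zero] at hgap
        exact sub_nonpos.1 (nonpos_of_mul_nonpos_right (by linarith) hpos)
    rw [hTr, EReal.coe_le_coe_iff] at hTc
    have hsq : ‖A (z k) - b‖ ^ 2 ≤ ηhat ^ 2 := by
      refine (hbound _ hdescent.2).trans ?_
      rw [div_le_iff₀ hcc, mul_comm (ηhat ^ 2) (c - chat)]
      gcongr
    exact (sq_le_sq₀ (norm_nonneg _) hηhat.le).1 hsq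
end
end

section
/- Let h : ℝ^n → (−∞,∞] be proper lower semicontinuous convex, let z ∈ dom h, and let g be differentiable on dom h with g(u) − ℓ_g(u;z̃) ≤ (M/2)‖u−z̃‖² for all z̃,u ∈ dom h, where M > 0. Let λ > 0, (z⁻, w, ε) ∈ ℝ^n × ℝ^n × ℝ_+, and ρ > 0 satisfy w ∈ ∂_ε( g + h + (1/(2λ))‖·−z⁻‖² )(z) and ‖(1/λ)(z⁻−z) + w‖ ≤ ρ. Set L := M + 1/λ and f := g + (1/(2λ))‖·−z⁻‖² − ⟨w, ·⟩; let z_f be a minimizer over ℝ^n of u ↦ ℓ_f(u; z) + h(u) + (L/2)‖u−z‖², q_f := L(z − z_f), δ_f := h(z) − h(z_f) − ⟨q_f − ∇f(z), z − z_f⟩, and v := q_f + (1/λ)(z⁻−z) + w. Then v ∈ ∇g(z) + ∂_{δ_f} h(z), 0 ≤ δ_f ≤ ε, and ‖v‖² + 2(M+1/λ)δ_f ≤ [ρ + √(2(M+1/λ)ε)]². -/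
open RealInnerProductSpace

noncomputable section

/-- First-order optimality for a quadratically regularized linear model of a convex function. -/
lemma ConvexEReal.subgradient_of_isMin_quadratic {n : ℕ} {h : EuclideanSpace ℝ (Fin n) → EReal}
    (hbot : ∀ x, h x ≠ ⊥) (hconv : ConvexEReal h) {c L : ℝ}
    {a z y : EuclideanSpace ℝ (Fin n)} (hy : h y ≠ ⊤)
    (hmin : ∀ u, ((c + ⟪a, y - z⟫ + L / 2 * ‖y - z‖ ^ 2 : ℝ) : EReal) + h y
      ≤ ((c + ⟪a, u - z⟫ + L / 2 * ‖u - z‖ ^ 2 : ℝ) : EReal) + h u)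
    {u : EuclideanSpace ℝ (Fin n)} (hu : h u ≠ ⊤) :
    (h y).toReal + ⟪L • (z - y) - a, u - y⟫ ≤ (h u).toReal := by
  have key : ∀ t : ℝ, t ∈ Set.Ioo (0 : ℝ) 1 →
      (h y).toReal + ⟪L • (z - y) - a, u - y⟫ ≤
        (h u).toReal + t * (L / 2 * ‖u - y‖ ^ 2) := by
    rintro t ⟨ht0, ht1⟩
    have h1 := hconv y u (1 - t) t (by linarith) ht0.le (by ring)
    have h2 := (hmin ((1 - t) • y + t • u)).trans (add_le_add_right h1 _)
    rw [← EReal.coe_toReal hy (hbot y), ← EReal.coe_toReal hu (hbot u)] at h2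
    norm_cast at h2
    have e : (1 - t) • y + t • u - z = (y - z) + t • (u - y) := by module
    have e' : L • (z - y) - a = -(L • (y - z)) - a := by module
    rw [e, norm_add_sq_real, inner_add_right, inner_smul_right, inner_smul_right, norm_smul,
      mul_pow, Real.norm_eq_abs, sq_abs] at h2
    rw [e', inner_sub_left, inner_neg_left, real_inner_smul_left]
    refine le_of_mul_le_mul_left ?_ ht0
    linarith
  have hlim : Filter.Tendsto (fun t : ℝ => (h u).toReal + t * (L / 2 * ‖u - y‖ ^ 2))
      (nhdsWithin 0 (Set.Ioi 0)) (nhds ((h u).toReal)) := by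
    have hc : Continuous fun t : ℝ => (h u).toReal + t * (L / 2 * ‖u - y‖ ^ 2) := by fun_prop
    simpa using (hc.tendsto 0).mono_left nhdsWithin_le_nhds
  refine ge_of_tendsto hlim ?_
  filter_upwards [Ioo_mem_nhdsGT (zero_lt_one' ℝ)] with t ht using key t ht

/-- The gradient of a function after adding a proximal term and subtracting a linear one. -/
lemma HasGradientAt.add_prox_sub_inner {E : Type*} [NormedAddCommGroup E]
    [InnerProductSpace ℝ E] [CompleteSpace E] {g : E → ℝ} {a x : E} (hg : HasGradientAt g a x)
    (c : ℝ) (y w : E) :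
    HasGradientAt (fun u => g u + 1 / (2 * c) * ‖u - y‖ ^ 2 - ⟪w, u⟫)
      (a + (1 / c) • (x - y) - w) x := by
  rw [hasGradientAt_iff_hasFDerivAt] at hg ⊢
  have hq := (((hasFDerivAt_id x).sub_const y).norm_sq).const_mul (1 / (2 * c))
  refine ((hg.add hq).sub (innerSL ℝ w).hasFDerivAt).congr_fderiv ?_
  ext d
  simp
  ring

/-- Lemma A.2(a) of the paper. From a prox-approximate solution
`(λ, z⁻, z, w, ε)`, setting `L = M + 1/λ`, `f = g + ‖· − z⁻‖²/(2λ) − ⟨w, ·⟩`, and letting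
`z_f, q_f, δ_f, v` be as defined, one has `v ∈ ∇g(z) + ∂_{δ_f}h(z)`, `0 ≤ δ_f ≤ ε`, and
`‖v‖² + 2(M + 1/λ)δ_f ≤ (ρ + √(2(M + 1/λ)ε))²`. -/
theorem prox_to_approx_solution {n : ℕ} (h : EuclideanSpace ℝ (Fin n) → EReal)
    (hproper : ProperFun h) (hlsc : LowerSemicontinuous h) (hconv : ConvexEReal h)
    (z : EuclideanSpace ℝ (Fin n)) (hz : z ∈ edom h)
    (g : EuclideanSpace ℝ (Fin n) → ℝ)
    (Gg : EuclideanSpace ℝ (Fin n) → EuclideanSpace ℝ (Fin n))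
    (M : ℝ) (hM : 0 < M)
    (hdiff : ∀ x ∈ edom h, HasGradientAt g (Gg x) x)
    (hcurv : ∀ zt ∈ edom h, ∀ u ∈ edom h,
      g u - (g zt + ⟪Gg zt, u - zt⟫) ≤ M / 2 * ‖u - zt‖ ^ 2)
    (lam : ℝ) (hlam : 0 < lam)
    (zm w : EuclideanSpace ℝ (Fin n)) (ε : ℝ) (hε0 : 0 ≤ ε) (ρ : ℝ) (hρ0 : 0 < ρ)
    (hw : w ∈ epsSubdiff
      (fun u => ((g u + 1 / (2 * lam) * ‖u - zm‖ ^ 2 : ℝ) : EReal) + h u) ((ε : ℝ) : EReal) z)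
    (hρ : ‖(1 / lam) • (zm - z) + w‖ ≤ ρ)
    (L : ℝ) (hL : L = M + 1 / lam)
    (f : EuclideanSpace ℝ (Fin n) → ℝ)
    (hf : ∀ x, f x = g x + 1 / (2 * lam) * ‖x - zm‖ ^ 2 - ⟪w, x⟫)
    (Gf : EuclideanSpace ℝ (Fin n) → EuclideanSpace ℝ (Fin n))
    (hGf : ∀ x ∈ edom h, HasGradientAt f (Gf x) x)
    (zf : EuclideanSpace ℝ (Fin n))
    (hzf : ∀ u : EuclideanSpace ℝ (Fin n),
      ((f z + ⟪Gf z, zf - z⟫ + L / 2 * ‖zf - z‖ ^ 2 : ℝ) : EReal) + h zf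
        ≤ ((f z + ⟪Gf z, u - z⟫ + L / 2 * ‖u - z‖ ^ 2 : ℝ) : EReal) + h u)
    (qf : EuclideanSpace ℝ (Fin n)) (hqf : qf = L • (z - zf))
    (δf : EReal) (hδf : δf = h z - h zf - ((⟪qf - Gf z, z - zf⟫ : ℝ) : EReal))
    (v : EuclideanSpace ℝ (Fin n)) (hv : v = qf + (1 / lam) • (zm - z) + w) :
    v - Gg z ∈ epsSubdiff h δf z ∧
    0 ≤ δf ∧ δf ≤ ((ε : ℝ) : EReal) ∧
    ((‖v‖ ^ 2 : ℝ) : EReal) + ((2 * (M + 1 / lam) : ℝ) : EReal) * δf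
      ≤ (((ρ + Real.sqrt (2 * (M + 1 / lam) * ε)) ^ 2 : ℝ) : EReal) := by
  have hbot := hproper.1
  have hzt : h z ≠ ⊤ := hz
  have hLpos : 0 < L := by rw [hL]; positivity
  have hzft : h zf ≠ ⊤ := by
    intro H
    have h1 := hzf z
    rw [H, EReal.coe_add_top, ← EReal.coe_toReal hzt (hbot z), ← EReal.coe_add] at h1
    exact EReal.coe_ne_top _ (top_le_iff.mp h1)
  have hG : Gf z = Gg z + (1 / lam) • (z - zm) - w := by
    have h1 := (hdiff z hz).add_prox_sub_inner lam zm w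
    rw [← funext hf] at h1
    exact (hGf z hz).unique h1
  have hvG : v - Gg z = qf - Gf z := by rw [hv, hG]; module
  have hsub : ∀ u, h u ≠ ⊤ → (h zf).toReal + ⟪qf - Gf z, u - zf⟫ ≤ (h u).toReal := fun u hu => by
    rw [hqf]
    exact hconv.subgradient_of_isMin_quadratic hbot hzft hzf hu
  obtain ⟨d, hd⟩ : ∃ d : ℝ, d = (h z).toReal - (h zf).toReal - ⟪qf - Gf z, z - zf⟫ := ⟨_, rfl⟩
  have hδ : δf = (d : EReal) := by
    rw [hδf, hd, ← EReal.coe_toReal hzt (hbot z), ← EReal.coe_toReal hzft (hbot zf)]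
    norm_cast
  have hqd : ‖qf‖ ^ 2 + 2 * L * d ≤ 2 * L * ε := by
    have h1 := hw zf
    have h2 := hcurv z hz zf hzft
    simp only [] at h1
    rw [← EReal.coe_toReal hzt (hbot z), ← EReal.coe_toReal hzft (hbot zf)] at h1
    norm_cast at h1
    have e1 : zf - zm = (zf - z) + (z - zm) := by abel
    have e2 : z - zf = -(zf - z) := by abel
    have e3 : (1 / (2 * lam)) = (1 / lam) / 2 := by field_simp
    rw [e1, norm_add_sq_real, e3] at h1
    rw [hqf, hG, e2, inner_neg_right, smul_neg] at hd
    generalize zf - z = p at *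
    rw [inner_sub_left, inner_neg_left, real_inner_smul_left, inner_sub_left, inner_add_left,
      real_inner_smul_left, real_inner_self_eq_norm_sq] at hd
    rw [real_inner_comm (z - zm) p] at h1
    have hdε : d + L / 2 * ‖p‖ ^ 2 ≤ ε := by
      rw [hL] at hd ⊢
      linarith
    have hq : ‖qf‖ ^ 2 = L * (L * ‖p‖ ^ 2) := by
      rw [hqf, e2, norm_smul, norm_neg, mul_pow, Real.norm_eq_abs, sq_abs]; ring
    rw [hq]
    nlinarith [mul_le_mul_of_nonneg_left hdε hLpos.le]
  have hd0 : 0 ≤ d := by linarith [hsub z hzt]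
  refine ⟨fun u => ?_, ?_, ?_, ?_⟩
  · by_cases hu : h u = ⊤
    · rw [hu]; exact le_top
    · have h1 := hsub u hu
      have e : u - zf = (u - z) + (z - zf) := by abel
      rw [e, inner_add_right] at h1
      rw [hvG, hδ, ← EReal.coe_toReal hzt (hbot z), ← EReal.coe_toReal hu (hbot u)]
      norm_cast
      linarith
  · rw [hδ]; exact_mod_cast hd0
  · rw [hδ]
    norm_cast
    refine le_of_mul_le_mul_left ?_ (by positivity : 0 < 2 * L)
    nlinarith [sq_nonneg ‖qf‖]
  · rw [hδ, ← hL]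
    norm_cast
    have hvn : ‖v‖ ≤ ‖qf‖ + ρ := by
      rw [hv, add_assoc]
      exact (norm_add_le _ _).trans (add_le_add_right hρ _)
    have hLε : 0 ≤ 2 * L * ε := by positivity
    have hqs : ‖qf‖ ≤ Real.sqrt (2 * L * ε) :=
      Real.le_sqrt_of_sq_le (by nlinarith [mul_nonneg hLpos.le hd0])
    have hv2 : ‖v‖ ^ 2 ≤ (‖qf‖ + ρ) ^ 2 := by gcongr
    nlinarith [Real.sq_sqrt hLε, mul_le_mul_of_nonneg_left hqs hρ0.le]
end
end

section
/- Let h : ℝ^n → (−∞,∞] be proper lower semicontinuous convex, let z ∈ dom h, and let g be differentiable on dom h with ∇g M-Lipschitz continuous on dom h, where M > 0. Let λ > 0, (z⁻, w, ε) ∈ ℝ^n × ℝ^n × ℝ_+, and ρ > 0 satisfy w ∈ ∂_ε( g + h + (1/(2λ))‖·−z⁻‖² )(z) and ‖(1/λ)(z⁻−z) + w‖ ≤ ρ. Set L := M + 1/λ and f := g + (1/(2λ))‖·−z⁻‖² − ⟨w, ·⟩; let z_f be a minimizer over ℝ^n of u ↦ ℓ_f(u; z) + h(u) + (L/2)‖u−z‖²,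 q_f := L(z − z_f), v := q_f + (1/λ)(z⁻−z) + w, and v_f := v + ∇g(z_f) − ∇g(z). Then v_f ∈ ∇g(z_f) + ∂h(z_f) and ‖v_f‖ ≤ ρ + 2√(2(M+1/λ)ε). -/
open RealInnerProductSpace

noncomputable section

theorem nonneg_of_forall_add_mul_nonneg {p c : ℝ}
    (H : ∀ t : ℝ, 0 < t → t ≤ 1 → 0 ≤ p + t * c) : 0 ≤ p := by
  have hlim : Filter.Tendsto (fun t : ℝ => p + t * c) (nhdsWithin 0 (Set.Ioi 0)) (nhds p) := by
    have hcont : Continuous fun t : ℝ => p + t * c := by fun_prop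
    simpa using (hcont.tendsto 0).mono_left nhdsWithin_le_nhds
  refine ge_of_tendsto hlim ?_
  filter_upwards [Ioc_mem_nhdsGT (zero_lt_one' ℝ)] with t ht
  exact H t ht.1 ht.2

theorem ConvexEReal.convex_edom {n : ℕ} {ψ : EuclideanSpace ℝ (Fin n) → EReal}
    (hconv : ConvexEReal ψ) (hbot : ∀ x, ψ x ≠ ⊥) : Convex ℝ (edom ψ) := by
  intro x hx y hy α β hα hβ hαβ
  lift ψ x to ℝ using ⟨hx, hbot x⟩ with a ha
  lift ψ y to ℝ using ⟨hy, hbot y⟩ with b hb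
  have hle := hconv x y α β hα hβ hαβ
  rw [← ha, ← hb] at hle
  exact ne_top_of_le_ne_top (EReal.coe_ne_top (α * a + β * b)) (by exact_mod_cast hle)

/-- The descent lemma on a convex set on which the gradient is Lipschitz. -/
theorem le_linearization_add_of_lipschitz_gradient {E : Type*} [NormedAddCommGroup E]
    [InnerProductSpace ℝ E] [CompleteSpace E] {s : Set E} (hs : Convex ℝ s) {g : E → ℝ}
    {G : E → E} {M : ℝ} (hG : ∀ x ∈ s, HasGradientAt g (G x) x)
    (hlip : ∀ x ∈ s, ∀ y ∈ s, ‖G x - G y‖ ≤ M * ‖x - y‖) {x y : E} (hx : x ∈ s) (hy : y ∈ s) :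
    g y ≤ g x + ⟪G x, y - x⟫ + M / 2 * ‖y - x‖ ^ 2 := by
  set d := y - x with hd
  have hmem : ∀ t ∈ Set.Icc (0 : ℝ) 1, x + t • d ∈ s := fun t ht =>
    hs.add_smul_sub_mem hx hy ht
  have hder : ∀ t ∈ Set.Icc (0 : ℝ) 1, HasDerivAt
      (fun t : ℝ => g (x + t • d) - t * ⟪G x, d⟫ - t ^ 2 * (M / 2 * ‖d‖ ^ 2))
      (⟪G (x + t • d), d⟫ - ⟪G x, d⟫ - 2 * t * (M / 2 * ‖d‖ ^ 2)) t := by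
    intro t ht
    have hline : HasDerivAt (fun t : ℝ => x + t • d) d t := by
      simpa using ((hasDerivAt_id t).smul_const d).const_add x
    have hcomp : HasDerivAt (fun t : ℝ => g (x + t • d)) ⟪G (x + t • d), d⟫ t := by
      simpa [Function.comp_def] using
        (hG _ (hmem t ht)).hasFDerivAt.comp_hasDerivAt t hline
    have hlin := (hasDerivAt_id t).mul_const ⟪G x, d⟫
    have hquad := (hasDerivAt_pow 2 t).mul_const (M / 2 * ‖d‖ ^ 2)
    exact ((hcomp.sub hlin).sub hquad).congr_deriv (by simp)
  have hanti := antitoneOn_of_deriv_nonpos (convex_Icc (0 : ℝ) 1)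
    (fun t ht => (hder t ht).continuousAt.continuousWithinAt)
    (fun t ht => (hder t (interior_subset ht)).differentiableAt.differentiableWithinAt)
    (fun t ht => by
      have ht' := interior_subset ht
      rw [(hder t ht').deriv, ← inner_sub_left]
      have hle := hlip _ (hmem t ht') _ hx
      rw [add_sub_cancel_left, norm_smul, Real.norm_of_nonneg ht'.1] at hle
      have hcs := real_inner_le_norm (G (x + t • d) - G x) d
      nlinarith [norm_nonneg d])
  have hle := hanti (Set.left_mem_Icc.2 zero_le_one) (Set.right_mem_Icc.2 zero_le_one)
    zero_le_one
  have hxy : x + (1 : ℝ) • d = y := by simp [hd]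
  simp only [hxy, zero_smul, add_zero] at hle
  linarith

/-- Optimality condition of a proximal step on a convex function linearized along `p`. -/
theorem mem_epsSubdiff_of_prox_minimizer {n : ℕ} {h : EuclideanSpace ℝ (Fin n) → EReal}
    (hproper : ProperFun h) (hconv : ConvexEReal h) {c L : ℝ}
    {p z zf : EuclideanSpace ℝ (Fin n)}
    (hzf : ∀ u : EuclideanSpace ℝ (Fin n),
      ((c + ⟪p, zf - z⟫ + L / 2 * ‖zf - z‖ ^ 2 : ℝ) : EReal) + h zf
        ≤ ((c + ⟪p, u - z⟫ + L / 2 * ‖u - z‖ ^ 2 : ℝ) : EReal) + h u) :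
    zf ∈ edom h ∧ L • (z - zf) - p ∈ epsSubdiff h 0 zf := by
  obtain ⟨hbot, x₀, hx₀⟩ := hproper
  have hzfd : h zf ≠ ⊤ := by
    intro htop
    have hle := hzf x₀
    lift h x₀ to ℝ using ⟨hx₀, hbot x₀⟩ with b
    rw [htop, EReal.coe_add_top, ← EReal.coe_add] at hle
    exact EReal.coe_ne_top _ (top_le_iff.1 hle)
  refine ⟨hzfd, fun u => ?_⟩
  by_cases hu : h u = ⊤
  · simp [hu]
  obtain ⟨a, ha⟩ : ∃ a : ℝ, (a : EReal) = h zf := ⟨_, EReal.coe_toReal hzfd (hbot zf)⟩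
  obtain ⟨b, hb⟩ : ∃ b : ℝ, (b : EReal) = h u := ⟨_, EReal.coe_toReal hu (hbot u)⟩
  suffices hreal : 0 ≤ b - a - ⟪L • (z - zf) - p, u - zf⟫ by
    rw [← ha, ← hb, sub_zero]
    exact_mod_cast (by linarith : a + ⟪L • (z - zf) - p, u - zf⟫ ≤ b)
  refine nonneg_of_forall_add_mul_nonneg (c := L / 2 * ‖u - zf‖ ^ 2) fun t ht ht1 => ?_
  have hle := (hzf ((1 - t) • zf + t • u)).trans
    (add_le_add_right (hconv zf u (1 - t) t (by linarith) ht.le (by ring)) _)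
  rw [← ha, ← hb] at hle
  have hle' : c + ⟪p, zf - z⟫ + L / 2 * ‖zf - z‖ ^ 2 + a ≤
      c + ⟪p, (1 - t) • zf + t • u - z⟫ + L / 2 * ‖(1 - t) • zf + t • u - z‖ ^ 2
        + ((1 - t) * a + t * b) := by exact_mod_cast hle
  have hpt : (1 - t) • zf + t • u - z = (zf - z) + t • (u - zf) := by module
  rw [hpt, inner_add_right, norm_add_sq_real, inner_smul_right, inner_smul_right, norm_smul,
    Real.norm_of_nonneg ht.le] at hle'
  rw [inner_sub_left, inner_smul_left, ← neg_sub zf z, inner_neg_left]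
  simp only [conj_trivial]
  refine nonneg_of_mul_nonneg_right ?_ ht
  linarith

/-- Lemma A.2(b) of the paper. If moreover `∇g` is `M`-Lipschitz on
`dom h`, then `v_f = v + ∇g(z_f) − ∇g(z)` satisfies `v_f ∈ ∇g(z_f) + ∂h(z_f)` and
`‖v_f‖ ≤ ρ + 2√(2(M + 1/λ)ε)`. -/
theorem prox_to_approx_solution_lipschitz {n : ℕ} (h : EuclideanSpace ℝ (Fin n) → EReal)
    (hproper : ProperFun h) (hlsc : LowerSemicontinuous h) (hconv : ConvexEReal h)
    (z : EuclideanSpace ℝ (Fin n)) (hz : z ∈ edom h)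
    (g : EuclideanSpace ℝ (Fin n) → ℝ)
    (Gg : EuclideanSpace ℝ (Fin n) → EuclideanSpace ℝ (Fin n))
    (M : ℝ) (hM : 0 < M)
    (hdiff : ∀ x ∈ edom h, HasGradientAt g (Gg x) x)
    (hlip : ∀ u ∈ edom h, ∀ zt ∈ edom h, ‖Gg u - Gg zt‖ ≤ M * ‖u - zt‖)
    (lam : ℝ) (hlam : 0 < lam)
    (zm w : EuclideanSpace ℝ (Fin n)) (ε : ℝ) (hε0 : 0 ≤ ε) (ρ : ℝ) (hρ0 : 0 < ρ)
    (hw : w ∈ epsSubdiff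
      (fun u => ((g u + 1 / (2 * lam) * ‖u - zm‖ ^ 2 : ℝ) : EReal) + h u) ((ε : ℝ) : EReal) z)
    (hρ : ‖(1 / lam) • (zm - z) + w‖ ≤ ρ)
    (L : ℝ) (hL : L = M + 1 / lam)
    (f : EuclideanSpace ℝ (Fin n) → ℝ)
    (hf : ∀ x, f x = g x + 1 / (2 * lam) * ‖x - zm‖ ^ 2 - ⟪w, x⟫)
    (Gf : EuclideanSpace ℝ (Fin n) → EuclideanSpace ℝ (Fin n))
    (hGf : ∀ x ∈ edom h, HasGradientAt f (Gf x) x)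
    (zf : EuclideanSpace ℝ (Fin n))
    (hzf : ∀ u : EuclideanSpace ℝ (Fin n),
      ((f z + ⟪Gf z, zf - z⟫ + L / 2 * ‖zf - z‖ ^ 2 : ℝ) : EReal) + h zf
        ≤ ((f z + ⟪Gf z, u - z⟫ + L / 2 * ‖u - z‖ ^ 2 : ℝ) : EReal) + h u)
    (qf : EuclideanSpace ℝ (Fin n)) (hqf : qf = L • (z - zf))
    (v : EuclideanSpace ℝ (Fin n)) (hv : v = qf + (1 / lam) • (zm - z) + w)
    (vf : EuclideanSpace ℝ (Fin n)) (hvf : vf = v + Gg zf - Gg z) :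
    vf - Gg zf ∈ epsSubdiff h (0 : EReal) zf ∧
    ‖vf‖ ≤ ρ + 2 * Real.sqrt (2 * (M + 1 / lam) * ε) := by
  have hbot := hproper.1
  have hLpos : 0 < L := by rw [hL]; positivity
  obtain ⟨hzfd, hsub⟩ := mem_epsSubdiff_of_prox_minimizer hproper hconv hzf
  have hGfz : Gf z = Gg z + (1 / lam) • (z - zm) - w := by
    refine (hGf z hz).unique ?_
    have hsq : HasFDerivAt (fun x => ‖x - zm‖ ^ 2) (2 • (innerSL ℝ (z - zm))) z := by
      simpa using ((hasFDerivAt_id z).sub_const zm).norm_sq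
    have hlin : HasFDerivAt (fun x => ⟪w, x⟫) (innerSL ℝ w) z := (innerSL ℝ w).hasFDerivAt
    have hfd := ((hdiff z hz).hasFDerivAt.add (hsq.const_mul (1 / (2 * lam)))).sub hlin
    rw [hasGradientAt_iff_hasFDerivAt, funext hf]
    refine hfd.congr_fderiv ?_
    ext y
    simp
    field_simp
  have hvsub : v - Gg z = L • (z - zf) - Gf z := by
    rw [hv, hqf, hGfz]; module
  have hdesc := le_linearization_add_of_lipschitz_gradient
    (hconv.convex_edom hbot) hdiff hlip hz hzfd
  refine ⟨?_, ?_⟩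
  · rwa [hvf, show v + Gg zf - Gg z - Gg zf = v - Gg z by abel, hvsub]
  have hgap : L / 2 * ‖zf - z‖ ^ 2 ≤ ε := by
    have hsubz := hsub z
    have hwz := hw zf
    obtain ⟨a, ha⟩ : ∃ a : ℝ, (a : EReal) = h zf := ⟨_, EReal.coe_toReal hzfd (hbot zf)⟩
    obtain ⟨b, hb⟩ : ∃ b : ℝ, (b : EReal) = h z := ⟨_, EReal.coe_toReal hz (hbot z)⟩
    rw [← ha, ← hb, sub_zero] at hsubz
    simp only [← ha, ← hb] at hwz
    have hsub' : a + ⟪L • (z - zf) - Gf z, z - zf⟫ ≤ b := by exact_mod_cast hsubz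
    have hw' : g z + 1 / (2 * lam) * ‖z - zm‖ ^ 2 + b + ⟪w, zf - z⟫ - ε ≤
        g zf + 1 / (2 * lam) * ‖zf - zm‖ ^ 2 + a := by exact_mod_cast hwz
    rw [show zf - zm = (z - zm) + (zf - z) by abel, norm_add_sq_real] at hw'
    rw [hGfz, ← neg_sub zf z, inner_neg_right, inner_sub_left, inner_sub_left, inner_add_left,
      inner_smul_left, inner_smul_left, inner_neg_left, real_inner_self_eq_norm_sq] at hsub'
    simp only [conj_trivial] at hsub'
    have hhalf : 1 / (2 * lam) = 1 / lam / 2 := by field_simp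
    rw [hhalf] at hw'
    rw [hL] at hsub' ⊢
    linarith
  have hLd : L * ‖zf - z‖ ≤ Real.sqrt (2 * (M + 1 / lam) * ε) := by
    rw [← hL]
    refine Real.le_sqrt_of_sq_le ?_
    nlinarith
  have hMd : M * ‖zf - z‖ ≤ L * ‖zf - z‖ :=
    mul_le_mul_of_nonneg_right (by rw [hL]; linarith [one_div_pos.2 hlam]) (norm_nonneg _)
  have hq : ‖qf‖ = L * ‖zf - z‖ := by
    rw [hqf, norm_smul, Real.norm_of_nonneg hLpos.le, norm_sub_rev]
  have hG := hlip zf hzfd z hz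
  calc ‖vf‖ = ‖((1 / lam) • (zm - z) + w) + qf + (Gg zf - Gg z)‖ := by
        rw [hvf, hv]; congr 1; abel
    _ ≤ ‖(1 / lam) • (zm - z) + w‖ + ‖qf‖ + ‖Gg zf - Gg z‖ := norm_add₃_le
    _ ≤ ρ + 2 * Real.sqrt (2 * (M + 1 / lam) * ε) := by linarith
end
end
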